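/- There exists a universal constant C > 0 such that for every N ≥ 1, if A is Haar-distributed on U(N) and Q_N(A) = 2 Σ_{k≥1} |Tr(A^k)|²/k², then |E[Q_N(A)] − 2 log N − (2γ + 2)| ≤ C/N and |Var(Q_N(A)) − 2π²/3| ≤ C/N, where γ is the Euler–Mascheroni constant. -/

import Mathlib

open MeasureTheory ProbabilityTheory Matrix

noncomputable section

instance matrixMeasurableSpace {m n α : Type*} [MeasurableSpace α] :
    MeasurableSpace (Matrix m n α) :=
  show MeasurableSpace (m → n → α) from inferInstance

/-- `Q_N(A) = 2 Σ_{k≥1} |Tr(A^k)|²/k²`. -/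
def Q (N : ℕ) (A : Matrix (Fin N) (Fin N) ℂ) : ℝ :=
  2 * ∑' k : ℕ, ‖(A ^ (k + 1)).trace‖ ^ 2 / ((k : ℝ) + 1) ^ 2

/-- Polynomials in the entries of a matrix and of its conjugate transpose. -/
abbrev EntryPoly (N : ℕ) : Type :=
  MvPolynomial ((Fin N × Fin N) ⊕ (Fin N × Fin N)) ℂ

/-- The values of the entries of `A` and of `Aᴴ`. -/
def entryVal {N : ℕ} (A : Matrix (Fin N) (Fin N) ℂ) :
    (Fin N × Fin N) ⊕ (Fin N × Fin N) → ℂ :=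
  Sum.elim (fun p => A p.1 p.2) (fun p => star (A p.2 p.1))

/-- The generic matrix. -/
def genA (N : ℕ) : Matrix (Fin N) (Fin N) (EntryPoly N) :=
  Matrix.of fun i j => MvPolynomial.X (Sum.inl (i, j))

/-- The conjugate transpose of the generic matrix. -/
def genB (N : ℕ) : Matrix (Fin N) (Fin N) (EntryPoly N) :=
  Matrix.of fun i j => MvPolynomial.X (Sum.inr (i, j))

/-- The derivation `A ↦ Z A`, `Aᴴ ↦ - Aᴴ Z`. -/
def leftDer {N : ℕ} (Z : Matrix (Fin N) (Fin N) ℂ) :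
    Derivation ℂ (EntryPoly N) (EntryPoly N) :=
  MvPolynomial.mkDerivation ℂ (Sum.elim
    (fun p => ∑ k, MvPolynomial.C (Z p.1 k) * genA N k p.2)
    (fun p => -∑ k, genB N p.1 k * MvPolynomial.C (Z k p.2)))

lemma MvPolynomial.hasDerivAt_eval_path {σ : Type*} (v : σ → MvPolynomial σ ℂ)
    (x : ℝ → σ → ℂ) (t : ℝ)
    (h : ∀ s, HasDerivAt (fun u => x u s) (MvPolynomial.eval (x t) (v s)) t)
    (P : MvPolynomial σ ℂ) :
    HasDerivAt (fun u => MvPolynomial.eval (x u) P)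
      (MvPolynomial.eval (x t) (MvPolynomial.mkDerivation ℂ v P)) t := by
  induction P using MvPolynomial.induction_on with
  | C a => simpa using hasDerivAt_const t a
  | add p q hp hq => simpa using hp.fun_add hq
  | mul_X p s hp =>
    have := hp.fun_mul (h s)
    simp only [Derivation.leibniz, MvPolynomial.mkDerivation_X, map_mul, map_add, smul_eq_mul,
      MvPolynomial.eval_X]
    refine this.congr_deriv ?_
    ring

lemma MvPolynomial.norm_eval_le {σ : Type*} (x : σ → ℂ) (hx : ∀ s, ‖x s‖ ≤ 1)
    (P : MvPolynomial σ ℂ) :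
    ‖MvPolynomial.eval x P‖ ≤ ∑ d ∈ P.support, ‖P.coeff d‖ := by
  rw [MvPolynomial.eval_eq]
  refine (norm_sum_le _ _).trans (Finset.sum_le_sum fun d _ => ?_)
  rw [norm_mul, norm_prod]
  refine mul_le_of_le_one_right (norm_nonneg _) (Finset.prod_le_one (fun _ _ => norm_nonneg _) ?_)
  intro i _
  rw [norm_pow]
  exact pow_le_one₀ (norm_nonneg _) (hx i)

lemma measurable_matrix_entry {N : ℕ} (i j : Fin N) :
    Measurable fun A : Matrix (Fin N) (Fin N) ℂ => A i j :=
  (measurable_pi_apply j).comp (measurable_pi_apply i)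

lemma measurable_eval_entryVal {N : ℕ} (P : EntryPoly N) :
    Measurable fun A : Matrix (Fin N) (Fin N) ℂ => MvPolynomial.eval (entryVal A) P := by
  induction P using MvPolynomial.induction_on with
  | C a => simp
  | add p q hp hq =>
    simp only [map_add]
    exact hp.add hq
  | mul_X p s hp =>
    simp only [map_mul, MvPolynomial.eval_X]
    refine hp.mul ?_
    rcases s with ⟨i, j⟩ | ⟨i, j⟩
    · exact measurable_matrix_entry i j
    · exact Complex.continuous_conj.measurable.comp (measurable_matrix_entry j i)

lemma measurable_matrix_mul_left {N : ℕ} (g : Matrix (Fin N) (Fin N) ℂ) :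
    Measurable fun A : Matrix (Fin N) (Fin N) ℂ => g * A := by
  refine measurable_pi_lambda _ fun i => measurable_pi_lambda _ fun j => ?_
  simp only [Matrix.mul_apply]
  exact Finset.measurable_sum _ fun k _ => (measurable_matrix_entry k j).const_mul _

lemma measurableSet_unitaryGroup (N : ℕ) :
    MeasurableSet {A : Matrix (Fin N) (Fin N) ℂ | A ∈ Matrix.unitaryGroup (Fin N) ℂ} := by
  have : {A : Matrix (Fin N) (Fin N) ℂ | A ∈ Matrix.unitaryGroup (Fin N) ℂ} =
      ⋂ i, ⋂ j, {A | ∑ k, A i k * star (A j k) = (1 : Matrix (Fin N) (Fin N) ℂ) i j} := by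
    ext A
    simp only [Set.mem_ofPred_eq, Matrix.mem_unitaryGroup_iff, Set.mem_iInter, ← Matrix.ext_iff,
      Matrix.mul_apply, Matrix.star_apply]
  rw [this]
  refine MeasurableSet.iInter fun i => MeasurableSet.iInter fun j => ?_
  refine measurableSet_eq_fun ?_ measurable_const
  exact Finset.measurable_sum _ fun k _ => (measurable_matrix_entry i k).mul
    (Complex.continuous_conj.measurable.comp (measurable_matrix_entry j k))

/-- `μ` is a left-invariant probability measure carried by the unitary group. -/
structure IsUnitaryHaar {N : ℕ} (μ : Measure (Matrix (Fin N) (Fin N) ℂ)) : Prop where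
  prob : IsProbabilityMeasure μ
  ae_mem : ∀ᵐ A ∂μ, A ∈ Matrix.unitaryGroup (Fin N) ℂ
  map_left_mul : ∀ g ∈ Matrix.unitaryGroup (Fin N) ℂ, μ.map (fun A => g * A) = μ

lemma norm_entryVal_le {N : ℕ} {A : Matrix (Fin N) (Fin N) ℂ}
    (hA : A ∈ Matrix.unitaryGroup (Fin N) ℂ) (s) : ‖entryVal A s‖ ≤ 1 := by
  rcases s with ⟨i, j⟩ | ⟨i, j⟩
  · exact entry_norm_bound_of_unitary hA i j
  · simpa [entryVal] using entry_norm_bound_of_unitary hA j i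

lemma IsUnitaryHaar.integrable_eval {N : ℕ} {μ : Measure (Matrix (Fin N) (Fin N) ℂ)}
    (h : IsUnitaryHaar μ) (P : EntryPoly N) :
    Integrable (fun A => MvPolynomial.eval (entryVal A) P) μ := by
  have := h.prob
  refine Integrable.of_bound (measurable_eval_entryVal P).aestronglyMeasurable
    (∑ d ∈ P.support, ‖P.coeff d‖) ?_
  filter_upwards [h.ae_mem] with A hA
  exact MvPolynomial.norm_eval_le _ (norm_entryVal_le hA) P

open scoped Matrix.Norms.L2Operator in
lemma hasDerivAt_exp_mul_entry {N : ℕ} (X A : Matrix (Fin N) (Fin N) ℂ) (t : ℝ) (i j : Fin N) :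
    HasDerivAt (fun u : ℝ => (NormedSpace.exp (u • X) * A) i j)
      ((X * (NormedSpace.exp (t • X) * A)) i j) t := by
  have h1 := (hasDerivAt_exp_smul_const' (𝕂 := ℝ) X t).mul_const A
  rw [Matrix.mul_assoc] at h1
  have h2 : HasDerivAt (fun u : ℝ => (NormedSpace.exp (u • X) * A)) _ t := h1
  let e : Matrix (Fin N) (Fin N) ℂ →L[ℝ] ℂ :=
    LinearMap.toContinuousLinearMap
      { toFun := fun M => M i j, map_add' := fun _ _ => rfl, map_smul' := fun _ _ => rfl }
  exact e.hasFDerivAt.comp_hasDerivAt t h2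

open scoped Matrix.Norms.L2Operator in
lemma exp_smul_mem_unitaryGroup {N : ℕ} {X : Matrix (Fin N) (Fin N) ℂ} (hX : star X = -X)
    (t : ℝ) : NormedSpace.exp (t • X) ∈ Matrix.unitaryGroup (Fin N) ℂ := by
  let _ : NormedAlgebra ℚ (Matrix (Fin N) (Fin N) ℂ) := NormedAlgebra.restrictScalars ℚ ℂ _
  refine NormedSpace.exp_mem_unitary_of_mem_skewAdjoint ?_
  rw [skewAdjoint.mem_iff, star_smul, hX]
  simp

lemma IsUnitaryHaar.integral_leftDer_of_skew {N : ℕ} {μ : Measure (Matrix (Fin N) (Fin N) ℂ)}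
    (h : IsUnitaryHaar μ) {X : Matrix (Fin N) (Fin N) ℂ} (hX : star X = -X) (P : EntryPoly N) :
    ∫ A, MvPolynomial.eval (entryVal A) (leftDer X P) ∂μ = 0 := by
  have := h.prob
  have hd : ∀ A t, HasDerivAt
      (fun u : ℝ => MvPolynomial.eval (entryVal (NormedSpace.exp (u • X) * A)) P)
      (MvPolynomial.eval (entryVal (NormedSpace.exp (t • X) * A)) (leftDer X P)) t := by
    intro A t
    refine MvPolynomial.hasDerivAt_eval_path _
      (fun u : ℝ => entryVal (NormedSpace.exp (u • X) * A)) t ?_ P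
    rintro (⟨i, j⟩ | ⟨i, j⟩)
    · refine (hasDerivAt_exp_mul_entry X A t i j).congr_deriv ?_
      rw [Matrix.mul_apply]
      simp [genA, entryVal]
    · refine ((hasDerivAt_exp_mul_entry X A t j i).star).congr_deriv ?_
      rw [Matrix.mul_apply]
      have hX' : ∀ a b, star (X a b) = - X b a := fun a b => by
        have := congrFun (congrFun hX b) a
        simpa [Matrix.star_apply] using this
      simp only [genB, entryVal, Sum.elim_inr, star_sum, star_mul', hX', map_neg, map_sum, map_mul,
        MvPolynomial.eval_C, Matrix.of_apply, MvPolynomial.eval_X, ← Finset.sum_neg_distrib]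
      refine Finset.sum_congr rfl fun k _ => by ring
  have key := hasDerivAt_integral_of_dominated_loc_of_deriv_le (μ := μ) (𝕜 := ℝ)
    (F := fun (t : ℝ) A => MvPolynomial.eval (entryVal (NormedSpace.exp (t • X) * A)) P)
    (F' := fun (t : ℝ) A =>
      MvPolynomial.eval (entryVal (NormedSpace.exp (t • X) * A)) (leftDer X P))
    (x₀ := 0) (s := Set.univ)
    (bound := fun _ => ∑ d ∈ (leftDer X P).support, ‖(leftDer X P).coeff d‖) Filter.univ_mem
    (Filter.Eventually.of_forall fun t => ((measurable_eval_entryVal P).comp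
      (measurable_matrix_mul_left _)).aestronglyMeasurable)
    (by simpa using h.integrable_eval P)
    ((measurable_eval_entryVal _).comp (measurable_matrix_mul_left _)).aestronglyMeasurable
    (by
      filter_upwards [h.ae_mem] with A hA t _
      exact MvPolynomial.norm_eval_le _
        (norm_entryVal_le (mul_mem (exp_smul_mem_unitaryGroup hX t) hA)) _)
    (integrable_const _)
    (Filter.Eventually.of_forall fun A t _ => hd A t)
  have hconst : (fun t : ℝ => ∫ A, MvPolynomial.eval (entryVal (NormedSpace.exp (t • X) * A)) P ∂μ)
      = fun _ => ∫ A, MvPolynomial.eval (entryVal A) P ∂μ := by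
    funext t
    conv_rhs => rw [← h.map_left_mul _ (exp_smul_mem_unitaryGroup hX t)]
    rw [integral_map (measurable_matrix_mul_left _).aemeasurable
      (measurable_eval_entryVal P).aestronglyMeasurable]
  have h2 := key.2
  rw [hconst] at h2
  simpa using h2.unique (hasDerivAt_const _ _)

lemma leftDer_add {N : ℕ} (Y Z : Matrix (Fin N) (Fin N) ℂ) (P : EntryPoly N) :
    leftDer (Y + Z) P = leftDer Y P + leftDer Z P := by
  have : leftDer (Y + Z) = leftDer Y + leftDer Z := by
    refine MvPolynomial.derivation_ext ?_
    rintro (⟨i, j⟩ | ⟨i, j⟩)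
    · simp [leftDer, MvPolynomial.mkDerivation_X, add_mul, Finset.sum_add_distrib]
    · simp [leftDer, MvPolynomial.mkDerivation_X, mul_add, Finset.sum_add_distrib]
      ring
  rw [this]; rfl

lemma leftDer_smul {N : ℕ} (c : ℂ) (Z : Matrix (Fin N) (Fin N) ℂ) (P : EntryPoly N) :
    leftDer (c • Z) P = c • leftDer Z P := by
  have : leftDer (c • Z) = c • leftDer Z := by
    refine MvPolynomial.derivation_ext ?_
    rintro (⟨i, j⟩ | ⟨i, j⟩)
    · simp [leftDer, MvPolynomial.mkDerivation_X, Finset.smul_sum, MvPolynomial.smul_eq_C_mul,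
        mul_assoc]
    · simp [leftDer, MvPolynomial.mkDerivation_X, Finset.smul_sum, MvPolynomial.smul_eq_C_mul,
        mul_left_comm]
  rw [this]; rfl

/-- Integration by parts: left-invariant derivatives have zero mean. -/
lemma IsUnitaryHaar.integral_leftDer {N : ℕ} {μ : Measure (Matrix (Fin N) (Fin N) ℂ)}
    (h : IsUnitaryHaar μ) (Z : Matrix (Fin N) (Fin N) ℂ) (P : EntryPoly N) :
    ∫ A, MvPolynomial.eval (entryVal A) (leftDer Z P) ∂μ = 0 := by
  have hZ : Z = (2⁻¹ : ℂ) • (Z - star Z) + (2⁻¹ * Complex.I) • ((-Complex.I) • (Z + star Z)) := by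
    rw [smul_smul]
    have : (2⁻¹ * Complex.I) * (-Complex.I) = (2⁻¹ : ℂ) := by
      rw [mul_assoc, mul_neg, Complex.I_mul_I]; simp
    rw [this, ← smul_add, sub_add_add_cancel, ← two_smul ℂ Z, smul_smul]
    simp
  rw [hZ, leftDer_add, leftDer_smul, leftDer_smul]
  simp only [map_add, MvPolynomial.smul_eval]
  rw [integral_add ((h.integrable_eval _).const_mul _) ((h.integrable_eval _).const_mul _),
    integral_const_mul, integral_const_mul,
    h.integral_leftDer_of_skew (by simp), h.integral_leftDer_of_skew]
  · simp
  · rw [star_smul, ← smul_neg]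
    simp [add_comm]

/-- Polynomials in formal power sums `p_k`, `k ∈ ℤ`. -/
abbrev PowerSumPoly : Type := MvPolynomial ℤ ℂ

/-- The integral powers of the generic matrix. -/
def genPow (N : ℕ) : ℤ → Matrix (Fin N) (Fin N) (EntryPoly N)
  | Int.ofNat n => genA N ^ n
  | Int.negSucc n => genB N ^ (n + 1)

/-- Substitution of the traces of powers for the power sums. -/
def traceHom (N : ℕ) : PowerSumPoly →ₐ[ℂ] EntryPoly N :=
  MvPolynomial.aeval fun m => (genPow N m).trace

/-- The derivation `p_k ↦ k p_{m+k}`. -/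
def shiftDer (m : ℤ) : Derivation ℂ PowerSumPoly PowerSumPoly :=
  MvPolynomial.mkDerivation ℂ fun k => (k : ℂ) • MvPolynomial.X (m + k)

/-- The quadratic term of the loop equation of index `m`. -/
def loopQuad : ℤ → PowerSumPoly
  | Int.ofNat n => ∑ l ∈ Finset.range n, MvPolynomial.X (l : ℤ) * MvPolynomial.X ((n : ℤ) - l)
  | Int.negSucc n => -∑ l ∈ Finset.range (n + 1),
      MvPolynomial.X (-((l : ℤ) + 1)) * MvPolynomial.X (-((n : ℤ) - l))

/-- The loop operator of index `m`. -/
def loopOp (m : ℤ) (G : PowerSumPoly) : PowerSumPoly := loopQuad m * G + shiftDer m G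

lemma Derivation.map_matrix_mul {n R S : Type*} [Fintype n] [CommRing R] [CommRing S]
    [Algebra R S] (D : Derivation R S S) (M M' : Matrix n n S) :
    (M * M').map D = M.map D * M' + M * M'.map D := by
  ext i j
  simp only [Matrix.map_apply, Matrix.mul_apply, Matrix.add_apply, map_sum, Derivation.leibniz,
    smul_eq_mul, ← Finset.sum_add_distrib]
  refine Finset.sum_congr rfl fun k _ => by ring

section TraceDerivative

variable {N : ℕ} (Z : Matrix (Fin N) (Fin N) ℂ)

lemma map_leftDer_genA : (genA N).map (leftDer Z) = Z.map MvPolynomial.C * genA N := by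
  ext1 i j
  simp [genA, leftDer, MvPolynomial.mkDerivation_X, Matrix.mul_apply]

lemma map_leftDer_genB : (genB N).map (leftDer Z) = -(genB N * Z.map MvPolynomial.C) := by
  ext1 i j
  simp [genB, leftDer, MvPolynomial.mkDerivation_X, Matrix.mul_apply]

lemma map_leftDer_one : (1 : Matrix (Fin N) (Fin N) (EntryPoly N)).map (leftDer Z) = 0 := by
  ext1 i j
  by_cases h : i = j <;> simp [h]

lemma map_leftDer_genA_pow (n : ℕ) : (genA N ^ n).map (leftDer Z) =
    ∑ l ∈ Finset.range n, genA N ^ l * Z.map MvPolynomial.C * genA N ^ (n - l) := by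
  induction n with
  | zero => simpa using map_leftDer_one Z
  | succ n ih =>
    rw [pow_succ, Derivation.map_matrix_mul, ih, map_leftDer_genA, Finset.sum_range_succ,
      Finset.sum_mul]
    refine congrArg₂ (· + ·) ?_ ?_
    · refine Finset.sum_congr rfl fun l hl => ?_
      have : n + 1 - l = n - l + 1 := by have := Finset.mem_range.1 hl; omega
      rw [this, pow_succ _ (_ - l)]
      simp only [Matrix.mul_assoc]
    · simp [Matrix.mul_assoc]

lemma map_leftDer_genB_pow (n : ℕ) : (genB N ^ n).map (leftDer Z) =
    -∑ l ∈ Finset.range n, genB N ^ (l + 1) * Z.map MvPolynomial.C * genB N ^ (n - 1 - l) := by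
  induction n with
  | zero => simpa using map_leftDer_one Z
  | succ n ih =>
    rw [pow_succ, Derivation.map_matrix_mul, ih, map_leftDer_genB, Finset.sum_range_succ,
      neg_add, neg_mul, Finset.sum_mul]
    refine congrArg₂ (· + ·) (congrArg _ ?_) ?_
    · refine Finset.sum_congr rfl fun l hl => ?_
      have : n + 1 - 1 - l = n - 1 - l + 1 := by have := Finset.mem_range.1 hl; omega
      rw [this, pow_succ _ (_ - l)]
      simp only [Matrix.mul_assoc]
    · simp [pow_succ, Matrix.mul_assoc]

lemma leftDer_trace (M : Matrix (Fin N) (Fin N) (EntryPoly N)) :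
    leftDer Z M.trace = (M.map (leftDer Z)).trace := by
  simp [Matrix.trace]

lemma leftDer_trace_genPow (m : ℤ) : leftDer Z (genPow N m).trace =
    (m : ℂ) • (genPow N m * Z.map MvPolynomial.C).trace := by
  rw [leftDer_trace]
  cases m with
  | ofNat n =>
    simp only [genPow]
    rw [map_leftDer_genA_pow, Matrix.trace_sum]
    have : ∀ l ∈ Finset.range n, (genA N ^ l * Z.map MvPolynomial.C * genA N ^ (n - l)).trace =
        (genA N ^ n * Z.map MvPolynomial.C).trace := fun l hl => by
      rw [Matrix.trace_mul_comm, ← Matrix.mul_assoc, ← pow_add]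
      congr 3
      have := Finset.mem_range.1 hl; omega
    rw [Finset.sum_congr rfl this]
    simp [MvPolynomial.smul_eq_C_mul]
  | negSucc n =>
    simp only [genPow]
    rw [map_leftDer_genB_pow, Matrix.trace_neg, Matrix.trace_sum]
    have : ∀ l ∈ Finset.range (n + 1),
        (genB N ^ (l + 1) * Z.map MvPolynomial.C * genB N ^ (n + 1 - 1 - l)).trace =
        (genB N ^ (n + 1) * Z.map MvPolynomial.C).trace := fun l hl => by
      rw [Matrix.trace_mul_comm, ← Matrix.mul_assoc, ← pow_add]
      congr 3
      have := Finset.mem_range.1 hl; omega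
    rw [Finset.sum_congr rfl this]
    simp [MvPolynomial.smul_eq_C_mul, Int.cast_negSucc]
    ring

lemma single_sandwich_apply (M M' : Matrix (Fin N) (Fin N) (EntryPoly N)) (i j : Fin N) :
    (M * (Matrix.single i j (1 : ℂ)).map MvPolynomial.C * M' :
      Matrix (Fin N) (Fin N) (EntryPoly N)) i j = M i i * M' j j := by
  have : (Matrix.single i j (1 : ℂ)).map (MvPolynomial.C : ℂ → EntryPoly N) =
      Matrix.single i j 1 := by
    rw [Matrix.map_single _ _ _ MvPolynomial.C]; simp
  rw [this, Matrix.mul_apply, Finset.sum_eq_single j]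
  · simp
  · intro k _ hk
    simp [Matrix.mul_single_apply_of_ne, hk]
  · simp

lemma trace_mul_single (M : Matrix (Fin N) (Fin N) (EntryPoly N)) (i j : Fin N) :
    (M * (Matrix.single i j (1 : ℂ)).map MvPolynomial.C).trace = M j i := by
  have : (Matrix.single i j (1 : ℂ)).map (MvPolynomial.C : ℂ → EntryPoly N) =
      Matrix.single i j 1 := by
    rw [Matrix.map_single _ _ _ MvPolynomial.C]; simp
  rw [this, Matrix.trace_mul_comm, Matrix.trace_single_mul]
  simp

lemma sum_leftDer_genPow (m : ℤ) :
    ∑ i, ∑ j, leftDer (Matrix.single i j 1) (genPow N m i j) = traceHom N (loopQuad m) := by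
  have h : ∀ i j, leftDer (Matrix.single i j 1) (genPow N m i j) =
    ((genPow N m).map (leftDer (Matrix.single i j 1))) i j := fun _ _ => rfl
  simp only [h]
  cases m with
  | ofNat n =>
    simp only [genPow, loopQuad, map_leftDer_genA_pow, Matrix.sum_apply, single_sandwich_apply,
      map_sum, map_mul]
    rw [Finset.sum_congr rfl fun i _ => Finset.sum_comm, Finset.sum_comm]
    refine Finset.sum_congr rfl fun l hl => ?_
    obtain ⟨k, rfl⟩ : ∃ k, n = l + k := ⟨n - l, by have := Finset.mem_range.1 hl; omega⟩
    have e : ((l + k : ℕ) : ℤ) - l = Int.ofNat k := by simp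
    rw [e, show ((l : ℕ) : ℤ) = Int.ofNat l from rfl]
    simp only [traceHom, MvPolynomial.aeval_X, genPow, Nat.add_sub_cancel_left, Matrix.trace,
      Matrix.diag_apply, Finset.sum_mul_sum]
  | negSucc n =>
    simp only [genPow, loopQuad, map_leftDer_genB_pow, Matrix.sum_apply, single_sandwich_apply,
      map_sum, map_mul, Matrix.neg_apply, map_neg, Finset.sum_neg_distrib]
    rw [Finset.sum_congr rfl fun i _ => Finset.sum_comm, Finset.sum_comm]
    congr 1
    refine Finset.sum_congr rfl fun l hl => ?_
    obtain ⟨k, rfl⟩ : ∃ k, n = l + k := ⟨n - l, by have := Finset.mem_range.1 hl; omega⟩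
    have e : -(((l + k : ℕ) : ℤ) - l) = -(k : ℤ) := by simp
    have e2 : -((l : ℤ) + 1) = Int.negSucc l := by rw [Int.negSucc_eq]
    have e3 : genPow N (-(k : ℤ)) = genB N ^ k := by
      cases k with
      | zero => simp [show (0 : ℤ) = Int.ofNat 0 from rfl, genPow, -Int.ofNat_eq_natCast]
      | succ k => exact congrArg (genPow N) (Int.negSucc_eq k).symm
    have e4 : l + k + 1 - 1 - l = k := by omega
    rw [e, e2, e4]
    simp only [traceHom, MvPolynomial.aeval_X, e3]
    simp only [genPow, Matrix.trace, Matrix.diag_apply, Finset.sum_mul_sum]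

lemma map_eval_genPow {A : Matrix (Fin N) (Fin N) ℂ} (hA : A ∈ Matrix.unitaryGroup (Fin N) ℂ)
    (m : ℤ) : (genPow N m).map (MvPolynomial.eval (entryVal A)) =
      (((⟨A, hA⟩ : Matrix.unitaryGroup (Fin N) ℂ) ^ m : Matrix.unitaryGroup (Fin N) ℂ) :
        Matrix (Fin N) (Fin N) ℂ) := by
  have hgA : (genA N).map (MvPolynomial.eval (entryVal A)) = A := by
    ext i j; simp [genA, entryVal]
  have hgB : (genB N).map (MvPolynomial.eval (entryVal A)) = star A := by
    ext i j; simp [genB, entryVal, Matrix.star_apply]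
  cases m with
  | ofNat n =>
    simp only [genPow, Int.ofNat_eq_natCast, zpow_natCast]
    rw [Matrix.map_pow, hgA]; rfl
  | negSucc n =>
    simp only [genPow, zpow_negSucc]
    rw [Matrix.map_pow, hgB, ← inv_pow]; rfl

lemma eval_traceHom_shiftDer {A : Matrix (Fin N) (Fin N) ℂ}
    (hA : A ∈ Matrix.unitaryGroup (Fin N) ℂ) (m : ℤ) (G : PowerSumPoly) :
    MvPolynomial.eval (entryVal A) (traceHom N (shiftDer m G)) =
      ∑ i, ∑ j, MvPolynomial.eval (entryVal A) (genPow N m i j) *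
        MvPolynomial.eval (entryVal A) (leftDer (Matrix.single i j 1) (traceHom N G)) := by
  induction G using MvPolynomial.induction_on with
  | C a =>
    have : traceHom N (MvPolynomial.C a) = MvPolynomial.C a := by
      simp [traceHom, MvPolynomial.algebraMap_eq]
    simp [this]
  | add p q hp hq =>
    simp only [map_add, hp, hq, mul_add, Finset.sum_add_distrib]
  | mul_X p k hp =>
    have hX : MvPolynomial.eval (entryVal A) (traceHom N (shiftDer m (MvPolynomial.X k))) =
        ∑ i, ∑ j, MvPolynomial.eval (entryVal A) (genPow N m i j) *
        MvPolynomial.eval (entryVal A) (leftDer (Matrix.single i j 1)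
          (traceHom N (MvPolynomial.X k))) := by
      simp only [shiftDer, MvPolynomial.mkDerivation_X, map_smul, traceHom, MvPolynomial.aeval_X,
        leftDer_trace_genPow, MvPolynomial.smul_eval, trace_mul_single]
      have hm := map_eval_genPow hA (m + k)
      rw [_root_.zpow_add, Matrix.UnitaryGroup.mul_val, ← map_eval_genPow hA, ← map_eval_genPow hA] at hm
      have := congrArg Matrix.trace hm
      simp only [Matrix.trace, Matrix.diag_apply, Matrix.map_apply, Matrix.mul_apply] at this
      rw [Matrix.trace, map_sum]
      simp only [Matrix.diag_apply]
      rw [this, Finset.mul_sum]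
      refine Finset.sum_congr rfl fun i _ => ?_
      rw [Finset.mul_sum]
      refine Finset.sum_congr rfl fun j _ => by ring
    simp only [Derivation.leibniz, map_mul, map_add, smul_eq_mul, hX, hp, Finset.mul_sum,
      ← Finset.sum_add_distrib]
    refine Finset.sum_congr rfl fun i _ => Finset.sum_congr rfl fun j _ => by ring

/-- Schwinger–Dyson (loop) equations for the traces of powers of a Haar unitary matrix. -/
lemma IsUnitaryHaar.integral_loopOp {μ : Measure (Matrix (Fin N) (Fin N) ℂ)}
    (h : IsUnitaryHaar μ) (m : ℤ) (G : PowerSumPoly) :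
    ∫ A, MvPolynomial.eval (entryVal A) (traceHom N (loopOp m G)) ∂μ = 0 := by
  have h1 : ∫ A, ∑ i, ∑ j, MvPolynomial.eval (entryVal A)
      (leftDer (Matrix.single i j 1) (genPow N m i j * traceHom N G)) ∂μ = 0 := by
    rw [integral_finsetSum _ fun i _ => integrable_finsetSum _ fun j _ => h.integrable_eval _]
    refine Finset.sum_eq_zero fun i _ => ?_
    rw [integral_finsetSum _ fun j _ => h.integrable_eval _]
    exact Finset.sum_eq_zero fun j _ => h.integral_leftDer _ _
  rw [← h1]
  refine integral_congr_ae ?_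
  filter_upwards [h.ae_mem] with A hA
  rw [loopOp, map_add, map_add, eval_traceHom_shiftDer hA, map_mul, map_mul, ← sum_leftDer_genPow,
    map_sum, Finset.sum_mul, ← Finset.sum_add_distrib]
  refine Finset.sum_congr rfl fun i _ => ?_
  rw [map_sum, Finset.sum_mul, ← Finset.sum_add_distrib]
  refine Finset.sum_congr rfl fun j _ => ?_
  simp only [Derivation.leibniz, map_add, map_mul, smul_eq_mul]
  ring

end TraceDerivative

/-- Laurent polynomials in `N` variables. -/
abbrev TorusPoly (N : ℕ) : Type := AddMonoidAlgebra ℂ (Fin N → ℤ)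

namespace TorusPoly

variable {N : ℕ}

/-- The monomial `z_i ^ m`. -/
def zp (i : Fin N) (m : ℤ) : TorusPoly N := AddMonoidAlgebra.single (Pi.single i m) 1

lemma zp_mul (i : Fin N) (m k : ℤ) : zp i m * zp i k = zp i (m + k) := by
  simp [zp, AddMonoidAlgebra.single_mul_single, Pi.single_add]

@[simp] lemma zp_zero (i : Fin N) : zp i 0 = 1 := by
  simp [zp, AddMonoidAlgebra.one_def]

/-- Multiplication of the coefficient of `z ^ l` by `c l`. -/
def coeffMul (c : (Fin N → ℤ) → ℂ) : TorusPoly N →ₗ[ℂ] TorusPoly N where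
  toFun x := AddMonoidAlgebra.ofCoeff
    (Finsupp.onFinset x.coeff.support (fun l => c l * x.coeff l) (by
      intro l hl
      exact Finsupp.mem_support_iff.2 (right_ne_zero_of_mul hl)))
  map_add' x y := by
    ext l
    simp [mul_add]
  map_smul' a x := by
    ext l
    simp [mul_left_comm]

@[simp] lemma coeff_coeffMul (c : (Fin N → ℤ) → ℂ) (x : TorusPoly N) (l : Fin N → ℤ) :
    (coeffMul c x).coeff l = c l * x.coeff l := rfl

lemma coeffMul_single (c : (Fin N → ℤ) → ℂ) (l : Fin N → ℤ) (r : ℂ) :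
    coeffMul c (AddMonoidAlgebra.single l r) = AddMonoidAlgebra.single l (c l * r) := by
  classical
  ext k
  by_cases h : l = k
  · subst h; simp
  · simp [h]

/-- The derivation `z_i ∂_i`. -/
def euler (i : Fin N) : Derivation ℂ (TorusPoly N) (TorusPoly N) :=
  Derivation.mk' (coeffMul fun l => (l i : ℂ)) (by
    intro x y
    induction x using AddMonoidAlgebra.induction_linear with
    | zero => simp
    | add p q hp hq => simp only [add_mul, map_add, hp, hq, add_smul, smul_add]; ring
    | single l r =>
      induction y using AddMonoidAlgebra.induction_linear with
      | zero => simp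
      | add p q hp hq => simp only [mul_add, map_add, hp, hq, add_smul, smul_add]; ring
      | single k s =>
        simp only [AddMonoidAlgebra.single_mul_single, coeffMul_single, smul_eq_mul]
        rw [add_comm k l, ← AddMonoidAlgebra.single_add]
        congr 1
        simp
        ring)

lemma coeff_euler (i : Fin N) (x : TorusPoly N) (l : Fin N → ℤ) :
    (euler i x).coeff l = (l i : ℂ) * x.coeff l := rfl

lemma euler_zp_self (i : Fin N) (m : ℤ) : euler i (zp i m) = (m : ℂ) • zp i m := by
  change coeffMul _ _ = _
  rw [zp, coeffMul_single]; simp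

lemma euler_zp_of_ne {i j : Fin N} (h : i ≠ j) (m : ℤ) : euler i (zp j m) = 0 := by
  change coeffMul _ _ = _
  rw [zp, coeffMul_single]; simp [h]

/-- The power sum `∑ z_i ^ m`. -/
def psum (N : ℕ) (m : ℤ) : TorusPoly N := ∑ i, zp i m

lemma psum_zero : psum N 0 = N := by simp [psum]

lemma euler_psum (i : Fin N) (m : ℤ) : euler i (psum N m) = (m : ℂ) • zp i m := by
  rw [psum, map_sum, Finset.sum_eq_single i, euler_zp_self]
  · intro j _ hj
    exact euler_zp_of_ne hj.symm m
  · simp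

/-- Substitution of the power sums of the variables for the formal power sums. -/
def torusHom (N : ℕ) : PowerSumPoly →ₐ[ℂ] TorusPoly N := MvPolynomial.aeval (psum N)

@[simp] lemma torusHom_X (m : ℤ) : torusHom N (MvPolynomial.X m) = psum N m := by
  simp [torusHom]

/-- The derivation `∑ z_i ^ m z_i ∂_i`. -/
def witt (N : ℕ) (m : ℤ) : Derivation ℂ (TorusPoly N) (TorusPoly N) := ∑ i, zp i m • euler i

lemma witt_apply (m : ℤ) (x : TorusPoly N) : witt N m x = ∑ i, zp i m * euler i x := by
  rw [witt, ← Derivation.coeFnAddMonoidHom_apply, map_sum, Finset.sum_apply]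
  rfl

lemma witt_zp (m k : ℤ) (i : Fin N) : witt N m (zp i k) = (k : ℂ) • zp i (m + k) := by
  rw [witt_apply, Finset.sum_eq_single i, euler_zp_self, mul_smul_comm, zp_mul]
  · intro j _ hj
    rw [euler_zp_of_ne hj, mul_zero]
  · simp

lemma witt_torusHom (m : ℤ) (F : PowerSumPoly) :
    witt N m (torusHom N F) = torusHom N (shiftDer m F) := by
  induction F using MvPolynomial.induction_on with
  | C a =>
    have : torusHom N (MvPolynomial.C a) = algebraMap ℂ _ a := by simp [torusHom]
    rw [this, Derivation.map_algebraMap, shiftDer, MvPolynomial.derivation_C, map_zero]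
  | add p q hp hq => simp only [map_add, hp, hq]
  | mul_X p k hp =>
    have : witt N m (psum N k) = (k : ℂ) • psum N (m + k) := by
      rw [psum, map_sum, psum, Finset.smul_sum]
      exact Finset.sum_congr rfl fun i _ => witt_zp m k i
    simp only [map_mul, Derivation.leibniz, hp, torusHom_X, this, map_add, smul_eq_mul, shiftDer,
      MvPolynomial.mkDerivation_X, map_smul]

/-- The Vandermonde determinant. -/
def vand (N : ℕ) : TorusPoly N := (Matrix.vandermonde fun i : Fin N => zp i 1).det

/-- The divided difference `(z_j ^ (m+1) - z_i ^ (m+1)) / (z_j - z_i)`. -/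
def divDiff (m : ℤ) (i j : Fin N) : TorusPoly N :=
  match m with
  | Int.ofNat n => ∑ l ∈ Finset.range (n + 1), zp i l * zp j (n - l)
  | Int.negSucc n => -∑ l ∈ Finset.range n, zp i (-(l + 1)) * zp j (-(n - l))

lemma sub_mul_divDiff (m : ℤ) (i j : Fin N) :
    (zp j 1 - zp i 1) * divDiff m i j = zp j (m + 1) - zp i (m + 1) := by
  cases m with
  | ofNat n =>
    have h := Finset.sum_range_sub' (fun l : ℕ => zp i (l : ℤ) * zp j ((n : ℤ) + 1 - l)) (n + 1)
    simp only [divDiff, Finset.mul_sum]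
    have e : ∀ l ∈ Finset.range (n + 1),
        (zp j 1 - zp i 1) * (zp i (l : ℤ) * zp j ((n : ℤ) - l)) =
        zp i (l : ℤ) * zp j ((n : ℤ) + 1 - l) -
          zp i ((l + 1 : ℕ) : ℤ) * zp j ((n : ℤ) + 1 - (l + 1 : ℕ)) := fun l _ => by
      have e1 : zp j ((n : ℤ) + 1 - l) = zp j 1 * zp j ((n : ℤ) - l) := by
        rw [zp_mul]; congr 1; ring
      have e2 : zp i ((l + 1 : ℕ) : ℤ) = zp i 1 * zp i (l : ℤ) := by
        rw [zp_mul]; congr 1; push_cast; ring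
      have e3 : ((n : ℤ) + 1 - (l + 1 : ℕ)) = n - l := by push_cast; ring
      rw [e1, e2, e3]; ring
    rw [Finset.sum_congr rfl e, h]
    simp
  | negSucc n =>
    have h := Finset.sum_range_sub (fun l : ℕ => zp i (-(l : ℤ)) * zp j (-((n : ℤ) - l))) n
    simp only [divDiff, mul_neg, Finset.mul_sum]
    have e : ∀ l ∈ Finset.range n,
        (zp j 1 - zp i 1) * (zp i (-((l : ℤ) + 1)) * zp j (-((n : ℤ) - l))) =
        zp i (-((l + 1 : ℕ) : ℤ)) * zp j (-((n : ℤ) - (l + 1 : ℕ))) -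
          zp i (-(l : ℤ)) * zp j (-((n : ℤ) - l)) := fun l _ => by
      have e1 : zp j (-((n : ℤ) - (l + 1 : ℕ))) = zp j 1 * zp j (-((n : ℤ) - l)) := by
        rw [zp_mul]; congr 1; push_cast; ring
      have e2 : zp i (-(l : ℤ)) = zp i 1 * zp i (-((l : ℤ) + 1)) := by
        rw [zp_mul]; congr 1; ring
      have e3 : (-((l + 1 : ℕ) : ℤ)) = -((l : ℤ) + 1) := by push_cast; ring
      rw [e1, e2, e3]; ring
    rw [Finset.sum_congr rfl e, h]
    have e4 : Int.negSucc n + 1 = -(n : ℤ) := by rw [Int.negSucc_eq]; ring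
    rw [e4]; simp

lemma divDiff_comm (m : ℤ) (i j : Fin N) : divDiff m i j = divDiff m j i := by
  cases m with
  | ofNat n =>
    simp only [divDiff]
    rw [← Finset.sum_range_reflect]
    refine Finset.sum_congr rfl fun l hl => ?_
    have := Finset.mem_range.1 hl
    rw [mul_comm]
    congr 2 <;> omega
  | negSucc n =>
    simp only [divDiff]
    rw [← Finset.sum_range_reflect]
    congr 1
    refine Finset.sum_congr rfl fun l hl => ?_
    have := Finset.mem_range.1 hl
    rw [mul_comm]
    congr 2 <;> omega

lemma divDiff_self (m : ℤ) (i : Fin N) : divDiff m i i = ((m : ℂ) + 1) • zp i m := by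
  cases m with
  | ofNat n =>
    simp only [divDiff, zp_mul]
    simp [← Nat.cast_smul_eq_nsmul ℂ, add_mul, Algebra.smul_def]
  | negSucc n =>
    simp only [divDiff, zp_mul]
    have : ∀ l ∈ Finset.range n, zp i (-((l : ℤ) + 1) + -((n : ℤ) - l)) = zp i (Int.negSucc n) :=
      fun l _ => by congr 1; rw [Int.negSucc_eq]; ring
    rw [Finset.sum_congr rfl this]
    simp [Int.cast_negSucc, ← Nat.cast_smul_eq_nsmul ℂ]

lemma sum_divDiff (m : ℤ) :
    ∑ i : Fin N, ∑ j, divDiff m i j = torusHom N (loopQuad m) + (N : ℂ) • psum N m := by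
  have hN : ∀ x : TorusPoly N, (N : ℂ) • x = x * psum N 0 := fun x => by
    rw [psum_zero, Algebra.smul_def]; simp [mul_comm]
  cases m with
  | ofNat n =>
    simp only [divDiff, loopQuad, map_sum, map_mul, torusHom_X]
    rw [Finset.sum_congr rfl fun i _ => Finset.sum_comm, Finset.sum_comm, Finset.sum_range_succ, hN]
    simp only [psum, Finset.sum_mul_sum, sub_self]
    rfl
  | negSucc n =>
    simp only [divDiff, loopQuad, map_sum, map_mul, torusHom_X, map_neg, Finset.sum_neg_distrib]
    rw [Finset.sum_congr rfl fun i _ => Finset.sum_comm, Finset.sum_comm, hN,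
      Finset.sum_range_succ, sub_self, neg_zero, Int.negSucc_eq, neg_add, neg_add_cancel_right]
    simp only [psum, Finset.sum_mul_sum]

lemma Derivation.map_prod_of_eigen {ι R S : Type*} [CommRing R] [CommRing S] [Algebra R S]
    (D : Derivation R S S) (s : Finset ι) (u h : ι → S) (hu : ∀ k ∈ s, D (u k) = u k * h k) :
    D (∏ k ∈ s, u k) = (∏ k ∈ s, u k) * ∑ k ∈ s, h k := by
  classical
  induction s using Finset.induction_on with
  | empty => simp
  | insert k s hk ih =>
    rw [Finset.prod_insert hk, Finset.sum_insert hk, Derivation.leibniz,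
      ih fun j hj => hu j (Finset.mem_insert_of_mem hj), hu k (Finset.mem_insert_self _ _)]
    simp only [smul_eq_mul]
    ring

lemma two_smul_witt_vand (m : ℤ) : (2 : ℂ) • witt N m (vand N) =
    vand N * (torusHom N (loopQuad m) + ((N : ℂ) - 1 - m) • psum N m) := by
  have h : witt N m (vand N) = vand N * ∑ i : Fin N, ∑ j ∈ Finset.Ioi i, divDiff m i j := by
    rw [vand, Matrix.det_vandermonde]
    refine Derivation.map_prod_of_eigen _ _ _ _ fun i _ =>
      Derivation.map_prod_of_eigen _ _ _ _ fun j _ => ?_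
    rw [sub_mul_divDiff, map_sub, witt_zp, witt_zp]
    simp
  have h2 := Finset.sum_sum_Ioi_add_eq_sum_sum_off_diag (fun i j : Fin N => divDiff m i j)
  have h3 : ∑ i : Fin N, ∑ j, divDiff m i j = ∑ i : Fin N, divDiff m i i +
      ∑ i : Fin N, ∑ j ∈ {i}ᶜ, divDiff m j i := by
    rw [Finset.sum_comm, ← Finset.sum_add_distrib]
    refine Finset.sum_congr rfl fun i _ => ?_
    rw [Fintype.sum_eq_add_sum_compl i]
  have h4 : ∑ i : Fin N, divDiff m i i = ((m : ℂ) + 1) • psum N m := by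
    simp only [divDiff_self, psum, Finset.smul_sum]
  rw [← h2, h4, sum_divDiff] at h3
  have h5 : ∑ i : Fin N, ∑ j ∈ Finset.Ioi i, (divDiff m j i + divDiff m i j) =
      (2 : ℂ) • ∑ i : Fin N, ∑ j ∈ Finset.Ioi i, divDiff m i j := by
    simp only [Finset.smul_sum]
    refine Finset.sum_congr rfl fun i _ => Finset.sum_congr rfl fun j _ => ?_
    rw [divDiff_comm m j i, two_smul]
  rw [h5] at h3
  rw [h, ← mul_smul_comm]
  congr 1
  have h6 := sub_eq_of_eq_add' h3
  rw [← h6]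
  module

lemma exists_chain_rule (F : PowerSumPoly) : ∃ s₀ : Finset ℤ, ∀ s, s₀ ⊆ s →
    ∀ D : Derivation ℂ (TorusPoly N) (TorusPoly N), D (torusHom N F) =
      ∑ m ∈ s, torusHom N (MvPolynomial.pderiv m F) * D (psum N m) := by
  induction F using MvPolynomial.induction_on with
  | C a =>
    refine ⟨∅, fun s _ D => ?_⟩
    have : torusHom N (MvPolynomial.C a) = algebraMap ℂ _ a := by simp [torusHom]
    rw [this, Derivation.map_algebraMap, eq_comm]
    exact Finset.sum_eq_zero fun m _ => by rw [MvPolynomial.pderiv_C, map_zero, zero_mul]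
  | add p q hp hq =>
    obtain ⟨s₁, h1⟩ := hp
    obtain ⟨s₂, h2⟩ := hq
    refine ⟨s₁ ∪ s₂, fun s hs D => ?_⟩
    simp only [map_add, add_mul, Finset.sum_add_distrib,
      h1 s (Finset.union_subset_left hs) D, h2 s (Finset.union_subset_right hs) D]
  | mul_X p k hp =>
    obtain ⟨s₁, h1⟩ := hp
    refine ⟨insert k s₁, fun s hs D => ?_⟩
    have hk : k ∈ s := hs (Finset.mem_insert_self _ _)
    simp only [map_mul, Derivation.leibniz, smul_eq_mul, torusHom_X, map_add, add_mul,
      Finset.sum_add_distrib, h1 s ((Finset.subset_insert _ _).trans hs) D, Finset.mul_sum,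
      MvPolynomial.pderiv_X]
    congr 1
    · rw [Finset.sum_eq_single k]
      · simp
      · intro m _ hm
        simp [hm.symm]
      · exact fun h => absurd hk h
    · exact Finset.sum_congr rfl fun m _ => by ring

/-- The eigenvalue of the radial Laplacian on the monomial `z ^ l`, shifted to vanish at
`l = (0, …, N - 1)`. -/
def eig (l : Fin N → ℤ) : ℤ :=
  ∑ i, (l i * (l i - (N - 1))) - ∑ i : Fin N, ((i : ℤ) * ((i : ℤ) - (N - 1)))

/-- The radial Laplacian conjugated by the Vandermonde determinant. -/
def radial (x : TorusPoly N) : TorusPoly N := coeffMul (fun l => (eig l : ℂ)) x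

lemma radial_eq (x : TorusPoly N) : radial x = ∑ i, euler i (euler i x) -
    ((N : ℂ) - 1) • ∑ i, euler i x -
    (∑ i : Fin N, (((i : ℕ) : ℂ) * (((i : ℕ) : ℂ) - (N - 1)))) • x := by
  ext l
  simp only [radial, coeff_coeffMul, AddMonoidAlgebra.coeff_sub, AddMonoidAlgebra.coeff_sum,
    AddMonoidAlgebra.coeff_smul, Finsupp.sub_apply, Finsupp.finsetSum_apply, coeff_euler,
    Finsupp.smul_apply, smul_eq_mul, Finset.mul_sum, eig]
  push_cast
  simp only [sub_mul, Finset.sum_mul, ← Finset.sum_sub_distrib]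
  refine Finset.sum_congr rfl fun i _ => ?_
  ring

lemma vand_eq_sum : vand N = ∑ σ : Equiv.Perm (Fin N),
    AddMonoidAlgebra.single (fun i => ((σ i : ℕ) : ℤ)) ((Equiv.Perm.sign σ : ℤ) : ℂ) := by
  have hpow : ∀ (i : Fin N) (n : ℕ), zp i 1 ^ n = zp i n := fun i n => by
    induction n with
    | zero => simp
    | succ n ih => rw [pow_succ, ih, zp_mul]; simp
  have hprod : ∀ (l : Fin N → ℤ) (s : Finset (Fin N)), ∏ i ∈ s, zp i (l i) =
      AddMonoidAlgebra.single (∑ i ∈ s, Pi.single i (l i)) 1 := fun l s => by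
    classical
    induction s using Finset.induction_on with
    | empty => simp [AddMonoidAlgebra.one_def]
    | insert k s hk ih =>
      rw [Finset.prod_insert hk, ih, Finset.sum_insert hk, zp, AddMonoidAlgebra.single_mul_single,
        mul_one]
  rw [vand, ← Matrix.det_transpose, Matrix.det_apply]
  refine Finset.sum_congr rfl fun σ _ => ?_
  simp only [Matrix.transpose_apply, Matrix.vandermonde_apply, hpow]
  rw [hprod fun i => ((σ i : ℕ) : ℤ), Finset.univ_sum_single]
  rcases Int.units_eq_one_or (Equiv.Perm.sign σ) with h | h <;> simp [h, Units.smul_def]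

lemma eig_perm (σ : Equiv.Perm (Fin N)) : eig (fun i => ((σ i : ℕ) : ℤ)) = 0 := by
  rw [eig, sub_eq_zero]
  exact Equiv.sum_comp σ fun i : Fin N => ((i : ℕ) : ℤ) * (((i : ℕ) : ℤ) - (N - 1))

lemma radial_vand : radial (vand N) = 0 := by
  rw [radial, vand_eq_sum, map_sum]
  refine Finset.sum_eq_zero fun σ _ => ?_
  rw [coeffMul_single, eig_perm]
  simp

/-- The radial part of the Laplacian, expressed with the loop operators. -/
lemma exists_loopOp_eq_radial (F : PowerSumPoly) : ∃ s : Finset ℤ,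
    vand N * torusHom N (∑ m ∈ s, (m : ℂ) • loopOp m (MvPolynomial.pderiv m F)) =
      radial (vand N * torusHom N F) := by
  obtain ⟨s, hs⟩ := exists_chain_rule (N := N) F
  refine ⟨s, ?_⟩
  have hs := hs s subset_rfl
  have h1 : ∀ i : Fin N, euler i (torusHom N F) =
      ∑ m ∈ s, (m : ℂ) • (zp i m * torusHom N (MvPolynomial.pderiv m F)) := fun i => by
    rw [hs]
    refine Finset.sum_congr rfl fun m _ => ?_
    rw [euler_psum, mul_smul_comm, mul_comm]
  have hcross : ∑ i : Fin N, euler i (vand N) * euler i (torusHom N F) =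
      ∑ m ∈ s, (m : ℂ) • (witt N m (vand N) * torusHom N (MvPolynomial.pderiv m F)) := by
    simp only [h1, Finset.mul_sum, witt_apply, Finset.sum_mul, Finset.smul_sum]
    rw [Finset.sum_comm]
    refine Finset.sum_congr rfl fun m _ => Finset.sum_congr rfl fun i _ => ?_
    rw [mul_smul_comm]; congr 1; ring
  have hsum : ∑ i : Fin N, euler i (torusHom N F) =
      ∑ m ∈ s, (m : ℂ) • (psum N m * torusHom N (MvPolynomial.pderiv m F)) := by
    simp only [h1, psum, Finset.sum_mul, Finset.smul_sum]
    rw [Finset.sum_comm]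
  have hsq : ∑ i : Fin N, euler i (euler i (torusHom N F)) =
      ∑ m ∈ s, (m : ℂ) • ((m : ℂ) • (psum N m * torusHom N (MvPolynomial.pderiv m F)) +
        torusHom N (shiftDer m (MvPolynomial.pderiv m F))) := by
    simp only [h1, map_sum]
    rw [Finset.sum_comm]
    refine Finset.sum_congr rfl fun m _ => ?_
    rw [← witt_torusHom, witt_apply, psum, Finset.sum_mul, Finset.smul_sum,
      ← Finset.sum_add_distrib, Finset.smul_sum]
    refine Finset.sum_congr rfl fun i _ => ?_
    rw [Derivation.map_smul, Derivation.leibniz, euler_zp_self]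
    simp only [smul_eq_mul, smul_mul_assoc, add_comm, mul_comm]
  have hexp : radial (vand N * torusHom N F) = torusHom N F * radial (vand N) +
      (2 : ℂ) • ∑ i : Fin N, euler i (vand N) * euler i (torusHom N F) +
      vand N * ∑ i : Fin N, euler i (euler i (torusHom N F)) -
      ((N : ℂ) - 1) • (vand N * ∑ i : Fin N, euler i (torusHom N F)) := by
    rw [radial_eq, radial_eq]
    simp only [Derivation.leibniz, map_add, smul_eq_mul, Finset.sum_add_distrib, ← Finset.mul_sum,
      Algebra.smul_def, map_ofNat]
    have hc : ∑ i : Fin N, euler i (torusHom N F) * euler i (vand N) =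
        ∑ i : Fin N, euler i (vand N) * euler i (torusHom N F) :=
      Finset.sum_congr rfl fun i _ => mul_comm _ _
    rw [hc]
    ring
  rw [hexp, radial_vand, mul_zero, zero_add, hcross, hsum, hsq, map_sum]
  simp only [Finset.mul_sum, Finset.smul_sum, ← Finset.sum_add_distrib, ← Finset.sum_sub_distrib]
  refine Finset.sum_congr rfl fun m _ => ?_
  rw [smul_comm (2 : ℂ) (m : ℂ), ← smul_mul_assoc, two_smul_witt_vand, loopOp]
  simp only [map_add, map_mul, Algebra.smul_def, map_sub, map_one, AlgHom.commutes]
  ring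

end TorusPoly

lemma Matrix.card_roots_charpoly {K n : Type*} [Field K] [IsAlgClosed K] [Fintype n]
    [DecidableEq n] (A : Matrix n n K) : Multiset.card A.charpoly.roots = Fintype.card n := by
  rw [← (IsAlgClosed.splits A.charpoly).natDegree_eq_card_roots, Matrix.charpoly_natDegree_eq_dim]

lemma Matrix.det_aeval_eq_prod_roots_charpoly {K n : Type*} [Field K] [IsAlgClosed K] [Fintype n]
    [DecidableEq n] (A : Matrix n n K) (p : Polynomial K) :
    (Polynomial.aeval A p).det = (A.charpoly.roots.map fun z => p.eval z).prod := by
  have hlin : ∀ w : K, (A - algebraMap K _ w).det = (A.charpoly.roots.map fun z => z - w).prod := by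
    intro w
    have h1 : A.charpoly.eval w = (A.charpoly.roots.map fun z => w - z).prod := by
      conv_lhs => rw [(IsAlgClosed.splits A.charpoly).eq_prod_roots_of_monic
        (Matrix.charpoly_monic A)]
      rw [Polynomial.eval_multiset_prod, Multiset.map_map]
      simp
    have h2 : (A.charpoly.roots.map fun z => z - w).prod =
        (-1) ^ Fintype.card n * (A.charpoly.roots.map fun z => w - z).prod := by
      have := Multiset.prod_map_neg (A.charpoly.roots.map fun z => w - z)
      rw [Multiset.map_map, Multiset.card_map, A.card_roots_charpoly] at this
      rw [← this]
      simp
    rw [h2, ← h1, Matrix.eval_charpoly, ← Matrix.det_neg, neg_sub]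
    rfl
  have key : ∀ (c : K) (s : Multiset K),
      (Polynomial.aeval A (Polynomial.C c *
        (s.map fun a => Polynomial.X - Polynomial.C a).prod)).det =
      (A.charpoly.roots.map fun z => (Polynomial.C c *
        (s.map fun a => Polynomial.X - Polynomial.C a).prod).eval z).prod := by
    intro c s
    induction s using Multiset.induction_on with
    | empty =>
      simp [Matrix.algebraMap_eq_diagonal, A.card_roots_charpoly]
    | cons a s ih =>
      simp only [Multiset.map_cons, Multiset.prod_cons, mul_left_comm (Polynomial.C c)]
      rw [map_mul, Matrix.det_mul, ih]
      simp only [Polynomial.eval_mul, Multiset.prod_map_mul]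
      rw [map_sub, Polynomial.aeval_X, Polynomial.aeval_C, hlin]
      simp
  rw [(IsAlgClosed.splits p).eq_prod_roots]
  exact key _ _

lemma Matrix.roots_charpoly_pow {K n : Type*} [Field K] [IsAlgClosed K] [Fintype n]
    [DecidableEq n] (A : Matrix n n K) (k : ℕ) :
    (A ^ k).charpoly.roots = A.charpoly.roots.map (· ^ k) := by
  have h : (A ^ k).charpoly =
      ((A.charpoly.roots.map (· ^ k)).map fun z => Polynomial.X - Polynomial.C z).prod := by
    refine Polynomial.funext fun t => ?_
    have := A.det_aeval_eq_prod_roots_charpoly (Polynomial.C t - Polynomial.X ^ k)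
    rw [Matrix.eval_charpoly, Polynomial.eval_multiset_prod, Multiset.map_map, Multiset.map_map]
    simp only [map_sub, map_pow, Polynomial.aeval_X, Polynomial.aeval_C, Polynomial.eval_sub,
      Polynomial.eval_C, Polynomial.eval_pow, Polynomial.eval_X] at this
    simpa [Matrix.algebraMap_eq_diagonal, Pi.algebraMap_def] using this
  rw [h, Polynomial.roots_multiset_prod_X_sub_C]

open scoped Matrix.Norms.L2Operator in
/-- The traces of the integral powers of a unitary matrix are power sums of points of the
circle. -/
lemma exists_trace_zpow_eq_sum {N : ℕ} {A : Matrix (Fin N) (Fin N) ℂ}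
    (hA : A ∈ Matrix.unitaryGroup (Fin N) ℂ) : ∃ z : Fin N → ℂ, (∀ i, z i ≠ 0) ∧ ∀ m : ℤ,
      (((⟨A, hA⟩ : Matrix.unitaryGroup (Fin N) ℂ) ^ m : Matrix.unitaryGroup (Fin N) ℂ) :
        Matrix (Fin N) (Fin N) ℂ).trace = ∑ i, z i ^ m := by
  obtain ⟨z, hz⟩ : ∃ z : Fin N → ℂ, A.charpoly.roots = Finset.univ.val.map z := by
    have hc := A.card_roots_charpoly
    rw [Fintype.card_fin] at hc
    generalize A.charpoly.roots = s at hc ⊢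
    rw [← Multiset.coe_toList s, Multiset.coe_card] at hc
    refine ⟨fun i => s.toList.get (i.cast hc.symm), ?_⟩
    conv_lhs => rw [← Multiset.coe_toList s]
    rw [Fin.univ_val_map]
    congr 1
    exact (List.ofFn_get _).symm.trans (List.ofFn_congr hc _)
  have hnorm : ∀ i, ‖z i‖ = 1 := fun i => by
    have hmem : z i ∈ A.charpoly.roots := by
      rw [hz]; exact Multiset.mem_map_of_mem _ (Finset.mem_univ_val i)
    exact spectrum.norm_eq_one_of_unitary hA
      (Matrix.mem_spectrum_of_isRoot_charpoly (Polynomial.isRoot_of_mem_roots hmem))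
  have hpow : ∀ n : ℕ, (A ^ n).trace = ∑ i, z i ^ n := fun n => by
    rw [Matrix.trace_eq_sum_roots_charpoly, Matrix.roots_charpoly_pow, hz, Multiset.map_map]
    rfl
  refine ⟨z, fun i h => by simpa [h] using hnorm i, fun m => ?_⟩
  cases m with
  | ofNat n => simpa using hpow n
  | negSucc n =>
    rw [zpow_negSucc]
    have : (((⟨A, hA⟩ : Matrix.unitaryGroup (Fin N) ℂ) ^ (n + 1))⁻¹ :
      Matrix.unitaryGroup (Fin N) ℂ).1 = (A ^ (n + 1))ᴴ := rfl
    rw [this, Matrix.trace_conjTranspose, hpow, star_sum]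
    refine Finset.sum_congr rfl fun i _ => ?_
    rw [zpow_negSucc, Complex.inv_def, Complex.normSq_eq_norm_sq]
    simp [hnorm]

namespace TorusPoly

variable {N : ℕ}

/-- The value at the identity permutation: `(0, …, N - 1)`. -/
def delta (N : ℕ) : Fin N → ℤ := fun i => ((i : ℕ) : ℤ)

lemma exists_eval_torusHom {A : Matrix (Fin N) (Fin N) ℂ}
    (hA : A ∈ Matrix.unitaryGroup (Fin N) ℂ) : ∃ φ : TorusPoly N →ₐ[ℂ] ℂ, ∀ F : PowerSumPoly,
      φ (torusHom N F) = MvPolynomial.eval (entryVal A) (traceHom N F) := by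
  obtain ⟨z, hz, h⟩ := exists_trace_zpow_eq_sum hA
  let e : Multiplicative (Fin N → ℤ) →* ℂ :=
    { toFun := fun l => ∏ i, z i ^ (l.toAdd i)
      map_one' := by simp
      map_mul' := fun l k => by
        simp [zpow_add₀ (hz _), Finset.prod_mul_distrib] }
  let φ : TorusPoly N →ₐ[ℂ] ℂ := AddMonoidAlgebra.lift ℂ ℂ (Fin N → ℤ) e
  refine ⟨φ, fun F => ?_⟩
  have hφ : ∀ m, φ (psum N m) = ∑ i, z i ^ m := fun m => by
    rw [psum, map_sum]
    refine Finset.sum_congr rfl fun i _ => ?_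
    simp only [φ, zp, AddMonoidAlgebra.lift_single, e, one_smul, MonoidHom.coe_mk, OneHom.coe_mk,
      toAdd_ofAdd]
    rw [Finset.prod_eq_single i]
    · simp
    · intro j _ hj
      simp [hj]
    · simp
  induction F using MvPolynomial.induction_on with
  | C a =>
    have h1 : torusHom N (MvPolynomial.C a) = algebraMap ℂ _ a := (torusHom N).commutes a
    have h2 : traceHom N (MvPolynomial.C a) = MvPolynomial.C a := (traceHom N).commutes a
    rw [h1, h2, AlgHom.commutes, MvPolynomial.eval_C]; rfl
  | add p q hp hq => simp only [map_add, hp, hq]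
  | mul_X p m hp =>
    simp only [map_mul, hp, torusHom_X, hφ, ← h, traceHom, MvPolynomial.aeval_X]
    rw [← map_eval_genPow hA]
    congr 1
    simp [Matrix.trace]

lemma coeff_vand_comp (σ : Equiv.Perm (Fin N)) (l : Fin N → ℤ) :
    (vand N).coeff (l ∘ σ) = ((Equiv.Perm.sign σ : ℤ) : ℂ) * (vand N).coeff l := by
  rw [vand_eq_sum]
  simp only [AddMonoidAlgebra.coeff_sum, Finsupp.finsetSum_apply, AddMonoidAlgebra.coeff_single,
    Finset.mul_sum]
  rw [← Equiv.sum_comp (Equiv.mulRight σ)]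
  refine Finset.sum_congr rfl fun τ _ => ?_
  have h : (fun i => (((Equiv.mulRight σ τ) i : ℕ) : ℤ)) = (fun i => ((τ i : ℕ) : ℤ)) ∘ σ := rfl
  rw [h]
  by_cases hl : (fun i => ((τ i : ℕ) : ℤ)) = l
  · rw [hl]
    simp [mul_comm]
  · rw [Finsupp.single_eq_of_ne, Finsupp.single_eq_of_ne (Ne.symm hl), mul_zero]
    intro h2
    exact hl (σ.surjective.injective_comp_right h2.symm)

lemma coeff_vand_delta : (vand N).coeff (delta N) = 1 := by
  rw [vand_eq_sum]
  simp only [AddMonoidAlgebra.coeff_sum, Finsupp.finsetSum_apply, AddMonoidAlgebra.coeff_single]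
  rw [Finset.sum_eq_single 1]
  · rw [show (fun i => (((1 : Equiv.Perm (Fin N)) i : ℕ) : ℤ)) = delta N from rfl,
      Finsupp.single_eq_same]
    simp
  · intro σ _ hσ
    refine Finsupp.single_eq_of_ne fun h => hσ (Equiv.ext fun i => ?_)
    have := congrFun h i
    simp only [delta] at this
    exact Fin.ext (by simpa using this.symm)
  · simp

lemma coeff_mul_psum (x : TorusPoly N) (m : ℤ) (l : Fin N → ℤ) :
    (x * psum N m).coeff l = ∑ i, x.coeff (l - Pi.single i m) := by
  rw [psum, Finset.mul_sum, AddMonoidAlgebra.coeff_sum, Finsupp.finsetSum_apply]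
  refine Finset.sum_congr rfl fun i _ => ?_
  rw [zp, AddMonoidAlgebra.coeff_mul_single_apply, mul_one, sub_eq_add_neg]

lemma coeff_vand_mul_torusHom_comp (F : PowerSumPoly) (σ : Equiv.Perm (Fin N)) (l : Fin N → ℤ) :
    (vand N * torusHom N F).coeff (l ∘ σ) =
      ((Equiv.Perm.sign σ : ℤ) : ℂ) * (vand N * torusHom N F).coeff l := by
  induction F using MvPolynomial.induction_on generalizing l with
  | C a =>
    have h1 : torusHom N (MvPolynomial.C a) = algebraMap ℂ _ a := (torusHom N).commutes a
    rw [h1, mul_comm, ← Algebra.smul_def]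
    simp [coeff_vand_comp, mul_left_comm]
  | add p q hp hq =>
    simp only [map_add, mul_add, AddMonoidAlgebra.coeff_add, Finsupp.add_apply, hp, hq]
  | mul_X p m hp =>
    rw [map_mul, ← mul_assoc, torusHom_X, coeff_mul_psum, coeff_mul_psum, Finset.mul_sum]
    refine (Finset.sum_congr rfl fun i _ => ?_).trans (Equiv.sum_comp σ _)
    rw [← hp]
    congr 1
    ext j
    simp [Pi.single_apply]

lemma coeff_vand_mul_torusHom_of_not_injective (F : PowerSumPoly) {l : Fin N → ℤ}
    (hl : ¬ Function.Injective l) : (vand N * torusHom N F).coeff l = 0 := by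
  obtain ⟨i, j, hij, hne⟩ : ∃ i j, l i = l j ∧ i ≠ j := by
    simpa [Function.Injective] using hl
  have h := coeff_vand_mul_torusHom_comp F (Equiv.swap i j) l
  have h2 : l ∘ Equiv.swap i j = l := by
    ext k
    simp only [Function.comp_apply, Equiv.swap_apply_def]
    split_ifs with h1 h2
    · rw [h1, hij]
    · rw [h2, hij]
    · rfl
  rw [h2, Equiv.Perm.sign_swap hne] at h
  simp only [Units.val_neg, Units.val_one, Int.cast_neg, Int.cast_one, neg_mul, one_mul] at h
  exact self_eq_neg.1 h

lemma exists_perm_of_eig_eq_zero {l : Fin N → ℤ} (hl : Function.Injective l) (h : eig l = 0) :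
    ∃ σ : Equiv.Perm (Fin N), l = delta N ∘ σ := by
  suffices hr : ∀ i, 0 ≤ l i ∧ l i < N by
    let f : Fin N → Fin N := fun i => ⟨(l i).toNat, by have := hr i; omega⟩
    have hf : Function.Injective f := fun i j hij => hl (by
      have h1 := hr i
      have h2 := hr j
      have := congrArg Fin.val hij
      simp only [f] at this
      omega)
    refine ⟨Equiv.ofBijective f (Finite.injective_iff_bijective.1 hf), funext fun i => ?_⟩
    have h1 := hr i
    simp only [delta, Function.comp_apply, Equiv.ofBijective_apply, f]
    omega
  classical
  let g : ℤ → ℤ := fun x => x * (x - (N - 1))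
  have hd : Function.Injective (delta N) := fun i j hij => by
    simpa [delta, Fin.val_inj] using hij
  have hsum : ∑ x ∈ Finset.univ.image l, g x = ∑ x ∈ Finset.univ.image (delta N), g x := by
    rw [Finset.sum_image hl.injOn, Finset.sum_image hd.injOn]
    exact sub_eq_zero.1 h
  have hmem : ∀ x, x ∈ Finset.univ.image (delta N) ↔ 0 ≤ x ∧ x < N := fun x => by
    simp only [Finset.mem_image, Finset.mem_univ, true_and, delta]
    constructor
    · rintro ⟨i, rfl⟩
      have := i.2
      omega
    · rintro ⟨h1, h2⟩
      exact ⟨⟨x.toNat, by omega⟩, by simp only []; omega⟩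
  have hsd := Finset.sum_sdiff_sub_sum_sdiff (s₁ := Finset.univ.image l)
    (s₂ := Finset.univ.image (delta N)) (f := g)
  rw [hsum, sub_self, sub_eq_zero] at hsd
  have hneg : ∑ x ∈ Finset.univ.image (delta N) \ Finset.univ.image l, g x ≤ 0 := by
    refine Finset.sum_nonpos fun x hx => ?_
    have := (hmem x).1 (Finset.mem_sdiff.1 hx).1
    exact mul_nonpos_of_nonneg_of_nonpos this.1 (by omega)
  intro i
  rw [← hmem]
  by_contra hi
  have hpos : ∀ x ∈ Finset.univ.image l \ Finset.univ.image (delta N), 0 < g x := by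
    intro x hx
    have h1 := (Finset.mem_sdiff.1 hx).2
    rw [hmem] at h1
    have hN : 0 < N := i.pos
    rcases lt_or_ge x 0 with h0 | h0
    · exact mul_pos_of_neg_of_neg h0 (by omega)
    · exact mul_pos (by omega) (by omega)
  have := Finset.sum_pos hpos ⟨l i, by simpa using hi⟩
  omega

end TorusPoly

namespace IsUnitaryHaar

open TorusPoly

variable {N : ℕ} {μ : Measure (Matrix (Fin N) (Fin N) ℂ)}

/-- The expectation of a polynomial in the traces of powers. -/
def expect (μ : Measure (Matrix (Fin N) (Fin N) ℂ)) (F : PowerSumPoly) : ℂ :=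
  ∫ A, MvPolynomial.eval (entryVal A) (traceHom N F) ∂μ

lemma expect_add (h : IsUnitaryHaar μ) (F G : PowerSumPoly) :
    expect μ (F + G) = expect μ F + expect μ G := by
  simp only [expect, map_add]
  exact integral_add (h.integrable_eval _) (h.integrable_eval _)

lemma expect_smul (c : ℂ) (F : PowerSumPoly) : expect μ (c • F) = c * expect μ F := by
  simp only [expect, map_smul, MvPolynomial.smul_eval]
  exact integral_const_mul _ _

lemma expect_sum (h : IsUnitaryHaar μ) {ι : Type*} (s : Finset ι) (F : ι → PowerSumPoly) :
    expect μ (∑ i ∈ s, F i) = ∑ i ∈ s, expect μ (F i) := by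
  simp only [expect, map_sum]
  exact integral_finsetSum _ fun i _ => h.integrable_eval _

lemma exists_radial (h : IsUnitaryHaar μ) (F : PowerSumPoly) : ∃ G, expect μ G = 0 ∧
    vand N * torusHom N G = radial (vand N * torusHom N F) := by
  obtain ⟨s, hs⟩ := exists_loopOp_eq_radial (N := N) F
  refine ⟨_, ?_, hs⟩
  rw [h.expect_sum]
  refine Finset.sum_eq_zero fun m _ => ?_
  rw [expect_smul, expect, h.integral_loopOp, mul_zero]

lemma exists_mul_prod (h : IsUnitaryHaar μ) (F : PowerSumPoly) (S : Finset ℤ) :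
    ∃ G, expect μ G = expect μ F ∧ ∀ l, (vand N * torusHom N G).coeff l =
      (∏ e ∈ S, (1 - (eig l : ℂ) / e)) * (vand N * torusHom N F).coeff l := by
  induction S using Finset.induction_on with
  | empty => exact ⟨F, rfl, fun l => by simp⟩
  | insert e S he ih =>
    obtain ⟨G, hG, hl⟩ := ih
    obtain ⟨K, hK, hr⟩ := h.exists_radial G
    refine ⟨G + (-(e : ℂ)⁻¹) • K, ?_, fun l => ?_⟩
    · rw [h.expect_add, expect_smul, hK, mul_zero, add_zero, hG]
    · have hk : (vand N * torusHom N K).coeff l = (eig l : ℂ) * (vand N * torusHom N G).coeff l := by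
        rw [hr]; rfl
      rw [Finset.prod_insert he, map_add, mul_add, map_smul, mul_smul_comm,
        AddMonoidAlgebra.coeff_add, AddMonoidAlgebra.coeff_smul, Finsupp.add_apply,
        Finsupp.smul_apply, hk, hl]
      simp only [smul_eq_mul]
      ring

/-- Weyl integration formula for polynomials in the traces of powers, in algebraic form. -/
theorem expect_eq_coeff (h : IsUnitaryHaar μ) (F : PowerSumPoly) :
    expect μ F = (vand N * torusHom N F).coeff (delta N) := by
  classical
  set v := vand N * torusHom N F with hv
  obtain ⟨G, hG, hl⟩ := h.exists_mul_prod F ((v.coeff.support.image eig).filter (· ≠ 0))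
  have hw : vand N * torusHom N G = v.coeff (delta N) • vand N := by
    ext l
    rw [AddMonoidAlgebra.coeff_smul, Finsupp.smul_apply, smul_eq_mul]
    by_cases hinj : Function.Injective l
    · by_cases he : eig l = 0
      · obtain ⟨σ, rfl⟩ := exists_perm_of_eig_eq_zero hinj he
        rw [coeff_vand_comp, coeff_vand_delta, hl, he, coeff_vand_mul_torusHom_comp]
        simp [hv, mul_comm]
      · have h0 : (vand N).coeff l = 0 := by
          have := congrArg (fun x => x.coeff l) (radial_vand (N := N))
          have h2 : (eig l : ℂ) * (vand N).coeff l = 0 := this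
          exact (mul_eq_zero.1 h2).resolve_left (by exact_mod_cast he)
        rw [h0, mul_zero, hl]
        by_cases hz : v.coeff l = 0
        · rw [← hv, hz, mul_zero]
        · rw [Finset.prod_eq_zero (i := eig l), zero_mul]
          · simp only [Finset.mem_filter, Finset.mem_image, Finsupp.mem_support_iff]
            exact ⟨⟨l, hz, rfl⟩, he⟩
          · rw [div_self (by exact_mod_cast he), sub_self]
    · have h1 := coeff_vand_mul_torusHom_of_not_injective 1 hinj
      rw [map_one, mul_one] at h1
      rw [h1, coeff_vand_mul_torusHom_of_not_injective G hinj, mul_zero]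
  have hne : vand N ≠ 0 := fun h0 => by
    have := coeff_vand_delta (N := N)
    rw [h0] at this
    simp at this
  have hc : torusHom N G = algebraMap ℂ _ (v.coeff (delta N)) := by
    refine mul_left_cancel₀ hne ?_
    rw [hw, Algebra.smul_def, mul_comm]
  have := h.prob
  rw [← hG, expect, integral_congr_ae (g := fun _ => v.coeff (delta N)), integral_const]
  · simp
  · filter_upwards [h.ae_mem] with A hA
    obtain ⟨φ, hφ⟩ := exists_eval_torusHom hA
    rw [← hφ, hc, AlgHom.commutes]
    rfl

end IsUnitaryHaar

namespace TorusPoly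

variable {N : ℕ}

/-- The coefficient of `z ^ l` in the product of the Vandermonde determinant with `F`. -/
def altCoeff (F : PowerSumPoly) (l : Fin N → ℤ) : ℂ := (vand N * torusHom N F).coeff l

lemma altCoeff_mul_X (F : PowerSumPoly) (m : ℤ) (l : Fin N → ℤ) :
    altCoeff (F * MvPolynomial.X m) l = ∑ i, altCoeff F (l - Pi.single i m) := by
  rw [altCoeff, map_mul, ← mul_assoc, torusHom_X, coeff_mul_psum]
  rfl

lemma altCoeff_eq_zero (F : PowerSumPoly) {l : Fin N → ℤ} {i j : Fin N} (h : i ≠ j)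
    (hl : l i = l j) : altCoeff F l = 0 :=
  coeff_vand_mul_torusHom_of_not_injective F fun hi => h (hi hl)

lemma altCoeff_swap (F : PowerSumPoly) (l : Fin N → ℤ) {i j : Fin N} (h : i ≠ j) :
    altCoeff F (l ∘ Equiv.swap i j) = -altCoeff F l := by
  rw [altCoeff, coeff_vand_mul_torusHom_comp, Equiv.Perm.sign_swap h, altCoeff]
  simp

lemma altCoeff_one_delta : altCoeff 1 (delta N) = 1 := by
  rw [altCoeff, map_one, mul_one, coeff_vand_delta]

lemma altCoeff_one_eq_zero_of_le {l : Fin N → ℤ} {i : Fin N} (h : (N : ℤ) ≤ l i) :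
    altCoeff 1 l = 0 := by
  rw [altCoeff, map_one, mul_one, vand_eq_sum]
  simp only [AddMonoidAlgebra.coeff_sum, Finsupp.finsetSum_apply, AddMonoidAlgebra.coeff_single]
  refine Finset.sum_eq_zero fun σ _ => Finsupp.single_eq_of_ne fun hl => ?_
  have := (σ i).2
  have h2 := congrFun hl i
  change l i = ((σ i : ℕ) : ℤ) at h2
  omega

/-- A variable whose exponent is raised to that of another one annihilates the coefficient. -/
lemma altCoeff_delta_add_eq_zero (F : PowerSumPoly) {w : Fin N} {k : ℤ} (hk : 0 < k)
    (h : ((w : ℕ) : ℤ) + k < N) {l : Fin N → ℤ} (hw : l w = w + k)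
    (hl : ∀ i : Fin N, ((i : ℕ) : ℤ) = w + k → l i = i) : altCoeff F l = 0 := by
  let v : Fin N := ⟨(((w : ℕ) : ℤ) + k).toNat, by omega⟩
  have hv : ((v : ℕ) : ℤ) = w + k := by simp only [v]; omega
  refine altCoeff_eq_zero F (i := w) (j := v) (fun e => ?_) ?_
  · rw [← e] at hv; omega
  · rw [hw, hl v hv, hv]

lemma altCoeff_one_delta_add_sub {i j : Fin N} (hij : i ≠ j) {d : ℤ} (hd : 0 < d) :
    altCoeff 1 (delta N + Pi.single i d - Pi.single j d) =
      if ((i : ℕ) : ℤ) + d = (j : ℕ) then -1 else 0 := by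
  split_ifs with h
  · rw [← altCoeff_one_delta (N := N), ← altCoeff_swap 1 (delta N) hij]
    congr 1
    ext k
    simp only [Pi.add_apply, Pi.sub_apply, delta, Pi.single_apply, Function.comp_apply,
      Equiv.swap_apply_def]
    split_ifs <;> simp_all
    omega
  · rcases lt_or_ge (((i : ℕ) : ℤ) + d) N with h1 | h1
    · refine altCoeff_delta_add_eq_zero 1 hd h1 (by simp [delta, hij]) fun k hk => ?_
      have hki : k ≠ i := fun e => by rw [e] at hk; omega
      have hkj : k ≠ j := fun e => by rw [e] at hk; omega
      simp [delta, hki, hkj]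
    · exact altCoeff_one_eq_zero_of_le (i := i) (by simpa [delta, hij] using h1)

lemma altCoeff_X_delta_add {w : Fin N} {k : ℤ} (hk : 0 < k) :
    altCoeff (MvPolynomial.X k) (delta N + Pi.single w k) =
      if (N : ℤ) ≤ w + k then 1 else 0 := by
  split_ifs with h
  · rw [← one_mul (MvPolynomial.X k), altCoeff_mul_X, Finset.sum_eq_single w]
    · rw [add_sub_cancel_right, altCoeff_one_delta]
    · intro s _ hs
      exact altCoeff_one_eq_zero_of_le (i := w) (by simpa [delta, hs.symm] using h)
    · simp
  · refine altCoeff_delta_add_eq_zero (w := w) _ hk (by omega) (by simp [delta]) fun i hi => ?_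
    have : i ≠ w := fun e => by rw [e] at hi; omega
    simp [delta, this]

/-- The second moment. -/
lemma altCoeff_second_moment {k : ℤ} (hk : 0 < k) :
    altCoeff (MvPolynomial.X k * MvPolynomial.X (-k)) (delta N) =
      ∑ w : Fin N, if (N : ℤ) ≤ w + k then 1 else 0 := by
  rw [altCoeff_mul_X]
  refine Finset.sum_congr rfl fun w _ => ?_
  rw [← altCoeff_X_delta_add hk, Pi.single_neg, sub_neg_eq_add]

lemma Finset.sum_sum_eq_of_cross {ι M : Type*} [Fintype ι] [DecidableEq ι] [AddCommGroup M]
    (f : ι → ι → M) (w : ι) (h : ∀ r s, r ≠ w → s ≠ w → f r s = 0) :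
    ∑ r, ∑ s, f r s = ∑ s, f w s + ∑ r, f r w - f w w := by
  rw [Fintype.sum_eq_add_sum_compl w, Fintype.sum_eq_add_sum_compl w fun r => f r w,
    Finset.sum_congr rfl fun r hr =>
      Fintype.sum_eq_single w fun s hs => h r s (by simpa using hr) hs]
  abel

lemma altCoeff_X_mul_X_delta_add {w : Fin N} {j k : ℤ} (hj : 0 < j) (hk : 0 < k) :
    altCoeff (MvPolynomial.X j * MvPolynomial.X k) (delta N + Pi.single w (j + k)) =
      if (N : ℤ) ≤ w + j + k then
        (if (N : ℤ) ≤ w + j then 1 else 0) + (if (N : ℤ) ≤ w + k then 1 else 0) - 1 else 0 := by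
  by_cases h : (N : ℤ) ≤ w + j + k
  · rw [if_pos h, altCoeff_mul_X]
    have e1 : altCoeff (MvPolynomial.X j) (delta N + Pi.single w (j + k) - Pi.single w k) =
        if (N : ℤ) ≤ w + j then 1 else 0 := by
      rw [← altCoeff_X_delta_add hj, Pi.single_add, add_sub_assoc, add_sub_cancel_right]
    have e2 : ∑ s, altCoeff 1 (delta N + Pi.single w (j + k) - Pi.single s k - Pi.single w j) =
        if (N : ℤ) ≤ w + k then 1 else 0 := by
      rw [← altCoeff_X_delta_add hk, ← one_mul (MvPolynomial.X k), altCoeff_mul_X]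
      refine Finset.sum_congr rfl fun s _ => ?_
      congr 1
      rw [Pi.single_add]
      abel
    have e3 : altCoeff 1 (delta N + Pi.single w (j + k) - Pi.single w k - Pi.single w j) = 1 := by
      rw [Pi.single_add, ← altCoeff_one_delta (N := N)]
      congr 1
      abel
    have e4 : ∀ μ : Fin N → ℤ, altCoeff (MvPolynomial.X j) μ =
        ∑ r, altCoeff 1 (μ - Pi.single r j) := fun μ => by rw [← altCoeff_mul_X, one_mul]
    rw [Finset.sum_congr rfl fun s _ => e4 _, Finset.sum_sum_eq_of_cross _ w, ← e4, e1, e2, e3]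
    intro r s hr hs
    exact altCoeff_one_eq_zero_of_le (i := w) (by
      simpa [delta, hr.symm, hs.symm, add_assoc] using h)
  · rw [if_neg h]
    refine altCoeff_delta_add_eq_zero (w := w) _ (by omega : 0 < j + k) (by omega) (by simp [delta])
      fun i hi => ?_
    have : i ≠ w := fun e => by rw [e] at hi; omega
    simp [delta, this]

/-- Both indices raised beyond the range. -/
lemma altCoeff_X_mul_X_of_le {i i' : Fin N} (hne : i ≠ i') {j k : ℤ}
    (h : (N : ℤ) ≤ i + j) (h' : (N : ℤ) ≤ i' + k) :
    altCoeff (MvPolynomial.X j * MvPolynomial.X k) (delta N + Pi.single i j + Pi.single i' k) =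
      1 + altCoeff 1 (delta N + Pi.single i j + Pi.single i' k - Pi.single i k -
        Pi.single i' j) := by
  rw [altCoeff_mul_X]
  have e4 : ∀ μ : Fin N → ℤ, altCoeff (MvPolynomial.X j) μ =
      ∑ r, altCoeff 1 (μ - Pi.single r j) := fun μ => by rw [← altCoeff_mul_X, one_mul]
  rw [Finset.sum_congr rfl fun s _ => e4 _]
  have hz : ∀ r s : Fin N, (i ≠ s ∧ i ≠ r) ∨ (i' ≠ s ∧ i' ≠ r) → altCoeff 1
      (delta N + Pi.single i j + Pi.single i' k - Pi.single s k - Pi.single r j) = 0 := by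
    rintro r s (⟨h1, h2⟩ | ⟨h1, h2⟩)
    · exact altCoeff_one_eq_zero_of_le (i := i) (by simpa [delta, h1, h2, hne] using h)
    · exact altCoeff_one_eq_zero_of_le (i := i') (by simpa [delta, h1, h2, hne.symm] using h')
  rw [Finset.sum_eq_add i' i hne.symm]
  · rw [Fintype.sum_eq_single i, Fintype.sum_eq_single i']
    · congr 1
      rw [← altCoeff_one_delta (N := N)]
      congr 1
      abel
    · intro r hr
      exact hz _ _ (Or.inr ⟨hne.symm, hr.symm⟩)
    · intro r hr
      exact hz _ _ (Or.inl ⟨hne, hr.symm⟩)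
  · intro s _ hs
    refine Finset.sum_eq_zero fun r _ => ?_
    by_cases hr : i = r
    · exact hz _ _ (Or.inr ⟨hs.1.symm, fun e => hne (hr.trans e.symm)⟩)
    · exact hz _ _ (Or.inl ⟨hs.2.symm, hr⟩)
  · simp
  · simp

/-- The first index raised within the range. -/
lemma altCoeff_delta_add_add_of_lt (F : PowerSumPoly) {i i' : Fin N} (hne : i ≠ i') {j k : ℤ}
    (hj : 0 < j) (h : ((i : ℕ) : ℤ) + j < N) :
    altCoeff F (delta N + Pi.single i j + Pi.single i' k) =
      if ((i' : ℕ) : ℤ) = i + j then -altCoeff F (delta N + Pi.single i (j + k)) else 0 := by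
  split_ifs with he
  · rw [← altCoeff_swap F _ hne]
    congr 1
    ext l
    simp only [Pi.add_apply, delta, Pi.single_apply, Function.comp_apply, Equiv.swap_apply_def]
    split_ifs <;> simp_all
    omega
  · refine altCoeff_delta_add_eq_zero (w := i) _ hj h (by simp [delta, hne]) fun l hl => ?_
    have h1 : l ≠ i := fun e => by rw [e] at hl; omega
    have h2 : l ≠ i' := fun e => by rw [e] at hl; omega
    simp [delta, h1, h2]

end TorusPoly

namespace TorusPoly

variable {N : ℕ}

lemma sum_ite_val_eq (x : ℤ) (c : ℂ) :
    ∑ i : Fin N, (if ((i : ℕ) : ℤ) = x then c else 0) = if 0 ≤ x ∧ x < N then c else 0 := by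
  split_ifs with h
  · rw [Fintype.sum_eq_single ⟨x.toNat, by omega⟩]
    · rw [if_pos (by simp only []; omega)]
    · intro i hi
      rw [if_neg fun e => hi (Fin.ext (by simp only []; omega))]
  · refine Finset.sum_eq_zero fun i _ => if_neg fun e => ?_
    have := i.2
    omega

lemma altCoeff_X_mul_X_delta_add_add {j k : ℤ} (hj : 0 < j) (hk : 0 < k) (i i' : Fin N) :
    altCoeff (MvPolynomial.X j * MvPolynomial.X k) (delta N + Pi.single i j + Pi.single i' k) =
      (if (N : ℤ) ≤ i + j then 1 else 0) * (if (N : ℤ) ≤ i' + k then 1 else 0) +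
      (if i ≠ i' ∧ (N : ℤ) ≤ i + j ∧ (N : ℤ) ≤ i' + k then altCoeff 1 (delta N + Pi.single i j +
        Pi.single i' k - Pi.single i k - Pi.single i' j) else 0) -
      (if ((i' : ℕ) : ℤ) = i + j then altCoeff (MvPolynomial.X j * MvPolynomial.X k)
        (delta N + Pi.single i (j + k)) else 0) -
      (if ((i : ℕ) : ℤ) = i' + k then altCoeff (MvPolynomial.X j * MvPolynomial.X k)
        (delta N + Pi.single i' (j + k)) else 0) +
      (if i' = i then altCoeff (MvPolynomial.X j * MvPolynomial.X k)
          (delta N + Pi.single i (j + k)) -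
        (if (N : ℤ) ≤ i + j then 1 else 0) * (if (N : ℤ) ≤ i + k then 1 else 0) else 0) := by
  have hi := i.2
  have hi' := i'.2
  rcases eq_or_ne i i' with rfl | hne
  · have h1 : ¬ ((i : ℕ) : ℤ) = i + j := by omega
    have h2 : ¬ ((i : ℕ) : ℤ) = i + k := by omega
    rw [if_neg h1, if_neg h2, if_neg (c := i ≠ i ∧ _) (fun h => h.1 rfl), if_pos rfl,
      add_assoc (delta N), ← Pi.single_add]
    ring
  · rw [if_neg (Ne.symm hne) (α := ℂ)]
    rcases lt_or_ge (((i : ℕ) : ℤ) + j) N with h | h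
    · rw [altCoeff_delta_add_add_of_lt _ hne hj h, if_neg (c := (N : ℤ) ≤ i + j) (by omega),
        if_neg (c := i ≠ i' ∧ _) (by omega)]
      by_cases h2 : ((i : ℕ) : ℤ) = i' + k
      · have h3 : ¬ ((i' : ℕ) : ℤ) = i + j := by omega
        rw [if_neg h3, if_neg h3, if_pos h2, altCoeff_X_mul_X_delta_add (w := i') hj hk,
          if_neg (c := (N : ℤ) ≤ i' + j + k) (by omega)]
        ring
      · rw [if_neg h2]
        split_ifs <;> ring
    · rcases lt_or_ge (((i' : ℕ) : ℤ) + k) N with h' | h'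
      · rw [add_right_comm, altCoeff_delta_add_add_of_lt _ hne.symm hk h',
          if_neg (c := (N : ℤ) ≤ i' + k) (by omega), if_neg (c := i ≠ i' ∧ _) (by omega),
          if_neg (c := ((i' : ℕ) : ℤ) = i + j) (by omega), add_comm k j]
        split_ifs <;> ring
      · rw [altCoeff_X_mul_X_of_le hne h h', if_pos h, if_pos h', if_pos ⟨hne, h, h'⟩,
          if_neg (by omega), if_neg (by omega)]
        ring

/-- The fourth moment. -/
lemma altCoeff_fourth_moment {j k : ℤ} (hj : 0 < j) (hk : 0 < k) :
    altCoeff (MvPolynomial.X j * MvPolynomial.X k * MvPolynomial.X (-k) * MvPolynomial.X (-j))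
        (delta N) =
      (∑ w : Fin N, if (N : ℤ) ≤ w + j then 1 else 0) *
        (∑ w : Fin N, if (N : ℤ) ≤ w + k then 1 else 0) +
      (∑ w : Fin N, if (N : ℤ) ≤ w + j + k ∧ w + j < (N : ℤ) ∧ w + k < (N : ℤ) then 1 else 0) +
      ∑ i : Fin N, ∑ i' : Fin N, if i ≠ i' ∧ (N : ℤ) ≤ i + j ∧ (N : ℤ) ≤ i' + k then
        altCoeff 1 (delta N + Pi.single i j + Pi.single i' k - Pi.single i k - Pi.single i' j)
        else 0 := by
  rw [altCoeff_mul_X]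
  simp only [altCoeff_mul_X _ (-k), Pi.single_neg, sub_neg_eq_add]
  simp only [altCoeff_X_mul_X_delta_add_add hj hk, Finset.sum_add_distrib, Finset.sum_sub_distrib]
  have hc : ∑ i : Fin N, ∑ i' : Fin N, (if ((i : ℕ) : ℤ) = i' + k then altCoeff
      (MvPolynomial.X j * MvPolynomial.X k) (delta N + Pi.single i' (j + k) : Fin N → ℤ) else 0) =
      ∑ i' : Fin N, ∑ i : Fin N, (if ((i : ℕ) : ℤ) = i' + k then altCoeff
      (MvPolynomial.X j * MvPolynomial.X k) (delta N + Pi.single i' (j + k)) else 0) :=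
    Finset.sum_comm
  rw [hc]
  simp only [sum_ite_val_eq, Finset.sum_ite_eq', Finset.mem_univ, if_true,
    ← Finset.mul_sum, ← Finset.sum_mul]
  have hw : ∀ w : Fin N, (if (N : ℤ) ≤ w + j + k ∧ w + j < (N : ℤ) ∧ w + k < (N : ℤ) then (1 : ℂ)
      else 0) = (altCoeff (MvPolynomial.X j * MvPolynomial.X k) (delta N + Pi.single w (j + k)) -
        (if (N : ℤ) ≤ w + j then 1 else 0) * (if (N : ℤ) ≤ w + k then 1 else 0)) -
      (if 0 ≤ (w : ℤ) + j ∧ (w : ℤ) + j < N then altCoeff (MvPolynomial.X j * MvPolynomial.X k)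
        (delta N + Pi.single w (j + k)) else 0) -
      (if 0 ≤ (w : ℤ) + k ∧ (w : ℤ) + k < N then altCoeff (MvPolynomial.X j * MvPolynomial.X k)
        (delta N + Pi.single w (j + k)) else 0) := by
    intro w
    rw [altCoeff_X_mul_X_delta_add hj hk]
    split_ifs <;> first | (exfalso; omega) | norm_num
  rw [Finset.sum_congr rfl fun w _ => hw w]
  simp only [Finset.sum_sub_distrib]
  ring

end TorusPoly

lemma Fin.card_filter_eq_of_iff {N : ℕ} (p : Fin N → Prop) [DecidablePred p] (a b : ℕ) (hb : b ≤ N)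
    (h : ∀ i : Fin N, p i ↔ a ≤ (i : ℕ) ∧ (i : ℕ) < b) :
    (Finset.univ.filter p).card = b - a := by
  rw [← Nat.card_Ico, ← Finset.card_map Fin.valEmbedding]
  congr 1
  ext x
  simp only [Finset.mem_map, Finset.mem_filter, Finset.mem_univ, true_and, Fin.valEmbedding_apply,
    Finset.mem_Ico]
  constructor
  · rintro ⟨i, hi, rfl⟩
    exact (h i).1 hi
  · intro hx
    exact ⟨⟨x, by omega⟩, (h _).2 hx, rfl⟩

lemma Fin.card_filter_le_of_imp {N : ℕ} (p : Fin N → Prop) [DecidablePred p] (a b : ℕ)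
    (h : ∀ i : Fin N, p i → a ≤ (i : ℕ) ∧ (i : ℕ) < b) :
    (Finset.univ.filter p).card ≤ b - a := by
  rw [← Nat.card_Ico, ← Finset.card_map Fin.valEmbedding]
  refine Finset.card_le_card fun x => ?_
  simp only [Finset.mem_map, Finset.mem_filter, Finset.mem_univ, true_and, Fin.valEmbedding_apply,
    Finset.mem_Ico]
  rintro ⟨i, hi, rfl⟩
  exact h i hi

namespace TorusPoly

variable {N : ℕ}

lemma sum_ite_le_add (k : ℕ) :
    (∑ w : Fin N, if (N : ℤ) ≤ w + (k : ℤ) then (1 : ℂ) else 0) = (min k N : ℕ) := by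
  rw [Finset.sum_boole, Fin.card_filter_eq_of_iff _ (N - k) N le_rfl fun i => by omega]
  congr 1
  omega

lemma fourth_moment_correction_of_lt {j k : ℤ} (hjk : j < k) :
    (∑ i : Fin N, ∑ i' : Fin N, if i ≠ i' ∧ (N : ℤ) ≤ i + j ∧ (N : ℤ) ≤ i' + k then
        altCoeff 1 (delta N + Pi.single i j + Pi.single i' k - Pi.single i k - Pi.single i' j)
        else 0) = -∑ i : Fin N, if (N : ℤ) ≤ i + j ∧ k ≤ i + j then 1 else 0 := by
  rw [← Finset.sum_neg_distrib]
  refine Finset.sum_congr rfl fun i _ => ?_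
  have e : ∀ i' : Fin N, (if i ≠ i' ∧ (N : ℤ) ≤ i + j ∧ (N : ℤ) ≤ i' + k then
        altCoeff 1 (delta N + Pi.single i j + Pi.single i' k - Pi.single i k - Pi.single i' j)
        else 0) = if ((i' : ℕ) : ℤ) = i + j - k then (if (N : ℤ) ≤ i + j then -1 else 0) else 0 := by
    intro i'
    rcases eq_or_ne i i' with rfl | hne
    · rw [if_neg (fun h => h.1 rfl), if_neg (by omega)]
    · have : delta N + Pi.single i j + Pi.single i' k - Pi.single i k - Pi.single i' j =
          delta N + Pi.single i' (k - j) - Pi.single i (k - j) := by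
        rw [Pi.single_sub, Pi.single_sub]
        abel
      rw [this, altCoeff_one_delta_add_sub hne.symm (by omega)]
      split_ifs <;> first | rfl | (exfalso; omega)
  rw [Finset.sum_congr rfl fun i' _ => e i', sum_ite_val_eq]
  have := i.2
  split_ifs <;> first | (exfalso; omega) | norm_num

lemma fourth_moment_correction_self (j : ℕ) :
    (∑ i : Fin N, ∑ i' : Fin N, if i ≠ i' ∧ (N : ℤ) ≤ i + (j : ℤ) ∧ (N : ℤ) ≤ i' + (j : ℤ) then
        altCoeff 1 (delta N + Pi.single i (j : ℤ) + Pi.single i' (j : ℤ) - Pi.single i (j : ℤ) -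
          Pi.single i' (j : ℤ))
        else 0) = ((min j N : ℕ) : ℂ) ^ 2 - (min j N : ℕ) := by
  have e : ∀ i i' : Fin N, (if i ≠ i' ∧ (N : ℤ) ≤ i + (j : ℤ) ∧ (N : ℤ) ≤ i' + (j : ℤ) then
        altCoeff 1 (delta N + Pi.single i (j : ℤ) + Pi.single i' (j : ℤ) - Pi.single i (j : ℤ) -
          Pi.single i' (j : ℤ))
        else 0) = (if (N : ℤ) ≤ i + (j : ℤ) then 1 else 0) * (if (N : ℤ) ≤ i' + (j : ℤ) then 1 else 0)
        - if i' = i then (if (N : ℤ) ≤ i + (j : ℤ) then 1 else 0) else 0 := by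
    intro i i'
    have : delta N + Pi.single i (j : ℤ) + Pi.single i' (j : ℤ) - Pi.single i (j : ℤ) -
          Pi.single i' (j : ℤ) = delta N := by abel
    rw [this, altCoeff_one_delta]
    rcases eq_or_ne i i' with rfl | hne
    · rw [if_neg (fun h => h.1 rfl), if_pos rfl]
      split_ifs <;> simp
    · rw [if_neg (Ne.symm hne)]
      split_ifs <;> simp_all
  simp only [e, Finset.sum_sub_distrib, ← Finset.mul_sum, ← Finset.sum_mul, Finset.sum_ite_eq',
    Finset.mem_univ, if_true, sum_ite_le_add]
  ring

end TorusPoly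

namespace IsUnitaryHaar

open TorusPoly

variable {N : ℕ} {μ : Measure (Matrix (Fin N) (Fin N) ℂ)}

lemma eval_traceHom_X {A : Matrix (Fin N) (Fin N) ℂ} (hA : A ∈ Matrix.unitaryGroup (Fin N) ℂ)
    (k : ℕ) : MvPolynomial.eval (entryVal A) (traceHom N (MvPolynomial.X (k : ℤ))) =
      (A ^ k).trace := by
  have h := congrArg Matrix.trace (map_eval_genPow hA k)
  rw [traceHom, MvPolynomial.aeval_X]
  refine (AddMonoidHom.map_trace (MvPolynomial.eval (entryVal A)).toAddMonoidHom _).trans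
    (h.trans ?_)
  rw [zpow_natCast]
  rfl

lemma eval_traceHom_X_neg {A : Matrix (Fin N) (Fin N) ℂ} (hA : A ∈ Matrix.unitaryGroup (Fin N) ℂ)
    (k : ℕ) : MvPolynomial.eval (entryVal A) (traceHom N (MvPolynomial.X (-(k : ℤ)))) =
      star (A ^ k).trace := by
  have h := congrArg Matrix.trace (map_eval_genPow hA (-k))
  rw [traceHom, MvPolynomial.aeval_X]
  refine (AddMonoidHom.map_trace (MvPolynomial.eval (entryVal A)).toAddMonoidHom _).trans
    (h.trans ?_)
  rw [_root_.zpow_neg, _root_.zpow_natCast, ← Matrix.trace_conjTranspose]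
  rfl

lemma eval_traceHom_sq {A : Matrix (Fin N) (Fin N) ℂ} (hA : A ∈ Matrix.unitaryGroup (Fin N) ℂ)
    (k : ℕ) : MvPolynomial.eval (entryVal A)
      (traceHom N (MvPolynomial.X (k : ℤ) * MvPolynomial.X (-(k : ℤ)))) =
      ((‖(A ^ k).trace‖ ^ 2 : ℝ) : ℂ) := by
  rw [map_mul, map_mul, eval_traceHom_X hA, eval_traceHom_X_neg hA]
  push_cast
  exact Complex.mul_conj' _

/-- The second moments of the traces of powers. -/
lemma integral_norm_trace_sq (h : IsUnitaryHaar μ) {k : ℕ} (hk : 0 < k) :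
    ∫ A, ‖(A ^ k).trace‖ ^ 2 ∂μ = (min k N : ℕ) := by
  have h1 := h.expect_eq_coeff (MvPolynomial.X (k : ℤ) * MvPolynomial.X (-(k : ℤ)))
  have h2 := altCoeff_second_moment (N := N) (k := k) (by exact_mod_cast hk)
  rw [altCoeff, ← h1, sum_ite_le_add, expect] at h2
  have h3 : ∫ A, MvPolynomial.eval (entryVal A)
      (traceHom N (MvPolynomial.X (k : ℤ) * MvPolynomial.X (-(k : ℤ)))) ∂μ =
      ∫ A, ((‖(A ^ k).trace‖ ^ 2 : ℝ) : ℂ) ∂μ :=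
    integral_congr_ae (h.ae_mem.mono fun A hA => eval_traceHom_sq hA k)
  rw [h3, integral_complex_ofReal, ← Complex.ofReal_natCast] at h2
  exact Complex.ofReal_injective h2

lemma integral_norm_trace_sq_mul (h : IsUnitaryHaar μ) (j k : ℕ) :
    ((∫ A, ‖(A ^ j).trace‖ ^ 2 * ‖(A ^ k).trace‖ ^ 2 ∂μ : ℝ) : ℂ) =
      altCoeff (N := N) (MvPolynomial.X (j : ℤ) * MvPolynomial.X (k : ℤ) *
        MvPolynomial.X (-(k : ℤ)) * MvPolynomial.X (-(j : ℤ))) (delta N) := by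
  rw [altCoeff, ← h.expect_eq_coeff, expect, ← integral_complex_ofReal]
  refine integral_congr_ae (h.ae_mem.mono fun A hA => ?_)
  have e : (MvPolynomial.X (j : ℤ) * MvPolynomial.X (k : ℤ) *
        MvPolynomial.X (-(k : ℤ)) * MvPolynomial.X (-(j : ℤ)) : PowerSumPoly) =
      (MvPolynomial.X (j : ℤ) * MvPolynomial.X (-(j : ℤ))) *
        (MvPolynomial.X (k : ℤ) * MvPolynomial.X (-(k : ℤ))) := by ring
  change _ = MvPolynomial.eval (entryVal A) (traceHom N _)
  rw [e, map_mul, map_mul, eval_traceHom_sq hA, eval_traceHom_sq hA]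
  exact Complex.ofReal_mul _ _

/-- The fourth moments of the traces of powers, up to a correction supported near the diagonal. -/
lemma exists_integral_norm_trace_sq_mul_eq_of_le (h : IsUnitaryHaar μ) (hN : 0 < N) {j k : ℕ}
    (hj : 0 < j) (hjk : j ≤ k) :
    ∃ c : ℝ, ∫ A, ‖(A ^ j).trace‖ ^ 2 * ‖(A ^ k).trace‖ ^ 2 ∂μ =
        (min j N : ℕ) * (min k N : ℕ) + (if j = k then ((min j N : ℕ) : ℝ) ^ 2 else 0) + c ∧
      |c| ≤ (min j N : ℕ) ∧ (c ≠ 0 → N < j + k ∧ k < j + N) := by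
  have hk : 0 < k := by omega
  have h0 := h.integral_norm_trace_sq_mul j k
  rw [altCoeff_fourth_moment (by exact_mod_cast hj) (by exact_mod_cast hk), sum_ite_le_add,
    sum_ite_le_add, Finset.sum_boole] at h0
  set p := (Finset.univ.filter fun w : Fin N =>
    (N : ℤ) ≤ w + (j : ℤ) + k ∧ w + (j : ℤ) < (N : ℤ) ∧ w + (k : ℤ) < (N : ℤ)).card with hp
  have hp1 : p ≤ (N - k) - (N - j - k) := Fin.card_filter_le_of_imp _ _ _ fun i hi => by omega
  have hp2 : j + k ≤ N → p = j := fun hle => by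
    rw [hp, Fin.card_filter_eq_of_iff _ (N - j - k) (N - k) (by omega) fun i => by omega]
    omega
  rcases hjk.eq_or_lt with rfl | hlt
  · rw [fourth_moment_correction_self] at h0
    refine ⟨(p : ℝ) - (min j N : ℕ), ?_, ?_, ?_⟩
    · rw [if_pos rfl]
      have : ((∫ A, ‖(A ^ j).trace‖ ^ 2 * ‖(A ^ j).trace‖ ^ 2 ∂μ : ℝ) : ℂ) =
        (((min j N : ℕ) * (min j N : ℕ) + ((min j N : ℕ) : ℝ) ^ 2 +
          ((p : ℝ) - (min j N : ℕ)) : ℝ) : ℂ) := by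
        rw [h0]; push_cast [-Nat.cast_min]; ring
      exact_mod_cast this
    · have : (p : ℝ) ≤ (min j N : ℕ) := by exact_mod_cast (by omega : p ≤ min j N)
      rw [abs_sub_comm, abs_of_nonneg (by linarith)]
      linarith [(Nat.cast_nonneg p : (0 : ℝ) ≤ p)]
    · intro hc
      refine ⟨?_, by omega⟩
      by_contra hcon
      refine hc ?_
      rw [hp2 (by omega), sub_eq_zero]
      exact_mod_cast (by omega : j = min j N)
  · rw [fourth_moment_correction_of_lt (by exact_mod_cast hlt), Finset.sum_boole] at h0
    set q := (Finset.univ.filter fun w : Fin N =>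
      (N : ℤ) ≤ w + (j : ℤ) ∧ (k : ℤ) ≤ w + (j : ℤ)).card with hq
    have hq1 : q = N - max (N - j) (k - j) := by
      rw [hq, Fin.card_filter_eq_of_iff _ (max (N - j) (k - j)) N le_rfl fun i => by omega]
    refine ⟨(p : ℝ) - q, ?_, ?_, ?_⟩
    · rw [if_neg hlt.ne]
      have : ((∫ A, ‖(A ^ j).trace‖ ^ 2 * ‖(A ^ k).trace‖ ^ 2 ∂μ : ℝ) : ℂ) =
        (((min j N : ℕ) * (min k N : ℕ) + 0 + ((p : ℝ) - q) : ℝ) : ℂ) := by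
        rw [h0]; push_cast [-Nat.cast_min]; ring
      exact_mod_cast this
    · have h1 : (p : ℝ) ≤ (min j N : ℕ) := by exact_mod_cast (by omega : p ≤ min j N)
      have h2 : (q : ℝ) ≤ (min j N : ℕ) := by exact_mod_cast (by omega : q ≤ min j N)
      rw [abs_le]
      constructor <;> linarith [(Nat.cast_nonneg p : (0 : ℝ) ≤ p), (Nat.cast_nonneg q : (0 : ℝ) ≤ q)]
    · intro hc
      by_contra hcon
      refine hc ?_
      rw [sub_eq_zero]
      rcases Nat.lt_or_ge N (j + k) with h1 | h1
      · exact_mod_cast (by omega : p = q)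
      · rw [hp2 h1]
        exact_mod_cast (by omega : j = q)

end IsUnitaryHaar

lemma sum_range_ite_le_inv_sq_le {N : ℕ} (hN : 0 < N) (K : ℕ) :
    ∑ k ∈ Finset.range K, (if N ≤ k then 1 / ((k : ℝ) + 1) ^ 2 else 0) ≤
      1 / (N : ℝ) - 1 / ((max K N : ℕ) : ℝ) := by
  have hN' : (0 : ℝ) < N := by exact_mod_cast hN
  induction K with
  | zero => simp
  | succ K ih =>
    rw [Finset.sum_range_succ]
    split_ifs with h
    · rw [max_eq_left h] at ih
      rw [max_eq_left (by omega)]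
      have hK : (0 : ℝ) < K := by exact_mod_cast (by omega : 0 < K)
      have : 1 / ((K : ℝ) + 1) ^ 2 ≤ 1 / K - 1 / ((K + 1 : ℕ) : ℝ) := by
        push_cast
        rw [div_sub_div _ _ (by positivity) (by positivity), div_le_div_iff₀ (by positivity)
          (by positivity)]
        nlinarith
      linarith
    · rw [max_eq_right (by omega)] at ih ⊢
      linarith

lemma sum_range_ite_inv_sq_le {N : ℕ} (hN : 0 < N) (K : ℕ) :
    ∑ k ∈ Finset.range K, (if N ≤ k then 1 / ((k : ℝ) + 1) ^ 2 else 0) ≤ 1 / (N : ℝ) :=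
  (sum_range_ite_le_inv_sq_le hN K).trans (sub_le_self _ (by positivity))

lemma le_sum_range_ite_inv_sq {N K : ℕ} (hK : N ≤ K) :
    1 / ((N : ℝ) + 1) - 1 / ((K : ℝ) + 1) ≤
      ∑ k ∈ Finset.range K, (if N ≤ k then 1 / ((k : ℝ) + 1) ^ 2 else 0) := by
  induction K, hK using Nat.le_induction with
  | base =>
    rw [sub_self]
    exact Finset.sum_nonneg fun k _ => by split_ifs <;> positivity
  | succ K hK ih =>
    rw [Finset.sum_range_succ, if_pos hK]
    have : 1 / ((K : ℝ) + 1) - 1 / (((K + 1 : ℕ) : ℝ) + 1) ≤ 1 / ((K : ℝ) + 1) ^ 2 := by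
      push_cast
      rw [div_sub_div _ _ (by positivity) (by positivity), div_le_div_iff₀ (by positivity)
          (by positivity)]
      nlinarith [(Nat.cast_nonneg K : (0 : ℝ) ≤ K)]
    linarith

lemma sum_min_div_sq {N K : ℕ} (hK : N ≤ K) :
    ∑ k ∈ Finset.range K, ((min (k + 1) N : ℕ) : ℝ) / ((k : ℝ) + 1) ^ 2 =
      (harmonic N : ℝ) + N * ∑ k ∈ Finset.range K, (if N ≤ k then 1 / ((k : ℝ) + 1) ^ 2 else 0) := by
  have hh : (harmonic N : ℝ) = ∑ k ∈ Finset.range K, if N ≤ k then 0 else 1 / ((k : ℝ) + 1) := by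
    rw [harmonic, ← Finset.sum_range_add_sum_Ico _ hK]
    rw [Finset.sum_congr rfl fun k hk => if_neg (by simpa using hk),
      Finset.sum_congr rfl (s₁ := Finset.Ico N K) fun k hk => if_pos (Finset.mem_Ico.1 hk).1]
    push_cast
    simp
  rw [hh, Finset.mul_sum, ← Finset.sum_add_distrib]
  refine Finset.sum_congr rfl fun k _ => ?_
  split_ifs with h
  · rw [min_eq_right (by omega)]
    ring
  · rw [min_eq_left (by omega)]
    push_cast
    field_simp
    simp

lemma abs_sum_min_div_sq_sub_le {N K : ℕ} (hN : 0 < N) (hK : N * N ≤ K) :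
    |∑ k ∈ Finset.range K, ((min (k + 1) N : ℕ) : ℝ) / ((k : ℝ) + 1) ^ 2 - (harmonic N : ℝ) - 1| ≤
      2 / (N : ℝ) := by
  have hN' : (1 : ℝ) ≤ N := by exact_mod_cast hN
  have hNK : N ≤ K := (Nat.le_mul_self N).trans hK
  rw [sum_min_div_sq hNK]
  have h1 := sum_range_ite_inv_sq_le hN K
  have h2 := le_sum_range_ite_inv_sq hNK
  set S := ∑ k ∈ Finset.range K, (if N ≤ k then 1 / ((k : ℝ) + 1) ^ 2 else 0)
  have h3 : 1 / ((K : ℝ) + 1) ≤ 1 / (N * N) :=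
    one_div_le_one_div_of_le (by positivity) (by
      have : (N : ℝ) * N ≤ K := by exact_mod_cast hK
      linarith)
  have h4 : (N : ℝ) * S ≤ N * (1 / N) := mul_le_mul_of_nonneg_left h1 (by positivity)
  have h5 : (N : ℝ) * (1 / (N + 1) - 1 / (N * N)) ≤ N * S :=
    mul_le_mul_of_nonneg_left (by linarith) (by positivity)
  have h6 : (N : ℝ) * (1 / N) = 1 := by field_simp
  have h7 : (N : ℝ) * (1 / (N + 1) - 1 / (N * N)) = 1 - 1 / (N + 1) - 1 / N := by field_simp; ring
  have h8 : 1 / ((N : ℝ) + 1) ≤ 1 / N := one_div_le_one_div_of_le (by positivity) (by linarith)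
  have h9 : 2 / (N : ℝ) = 1 / N + 1 / N := by ring
  have h10 : 0 < 1 / (N : ℝ) := by positivity
  rw [abs_le]
  constructor <;> linarith

lemma abs_harmonic_sub_le {N : ℕ} (hN : 0 < N) :
    |(harmonic N : ℝ) - Real.log N - Real.eulerMascheroniConstant| ≤ 1 / N := by
  have hN' : (0 : ℝ) < N := by exact_mod_cast hN
  have h1 := Real.eulerMascheroniSeq_lt_eulerMascheroniConstant N
  have h2 := Real.eulerMascheroniConstant_lt_eulerMascheroniSeq' N
  rw [Real.eulerMascheroniSeq] at h1
  rw [Real.eulerMascheroniSeq', if_neg hN.ne'] at h2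
  have h3 : Real.log ((N : ℝ) + 1) - Real.log N ≤ 1 / N := by
    rw [← Real.log_div (by positivity) (by positivity)]
    refine (Real.log_le_sub_one_of_pos (by positivity)).trans (le_of_eq ?_)
    field_simp
    ring
  rw [abs_le]
  constructor <;> linarith

lemma abs_sum_min_sq_div_sub_le {N : ℕ} (hN : 0 < N) (K : ℕ) :
    |∑ k ∈ Finset.range K, ((min (k + 1) N : ℕ) : ℝ) ^ 2 / ((k : ℝ) + 1) ^ 4 -
      ∑ k ∈ Finset.range K, 1 / ((k : ℝ) + 1) ^ 2| ≤ 1 / (N : ℝ) := by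
  rw [abs_sub_comm, ← Finset.sum_sub_distrib]
  refine (Finset.abs_sum_le_sum_abs _ _).trans
    ((Finset.sum_le_sum fun k _ => ?_).trans (sum_range_ite_inv_sq_le hN K))
  have e : 1 / ((k : ℝ) + 1) ^ 2 = ((k : ℝ) + 1) ^ 2 / ((k : ℝ) + 1) ^ 4 := by field_simp
  split_ifs with h
  · have h1 : ((min (k + 1) N : ℕ) : ℝ) ≤ (k : ℝ) + 1 := by exact_mod_cast min_le_left _ _
    have h2 : ((min (k + 1) N : ℕ) : ℝ) ^ 2 / ((k : ℝ) + 1) ^ 4 ≤ 1 / ((k : ℝ) + 1) ^ 2 := by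
      rw [e]
      gcongr
    rw [abs_of_nonneg (sub_nonneg.2 h2)]
    exact sub_le_self _ (by positivity)
  · rw [min_eq_left (by omega), e]
    simp

/-- A dominating function for the off-diagonal corrections. -/
def corrBound (N j k : ℕ) : ℝ :=
  (if j + 1 ≤ N ∧ N < j + k + 2 ∧ k < j + N then 4 / (((j : ℝ) + 1) * N ^ 2) else 0) +
  (if N ≤ j then 1 / ((j : ℝ) + 1) ^ 2 else 0) * (N * if N ≤ k then 1 / ((k : ℝ) + 1) ^ 2 else 0)

lemma corrBound_nonneg (N j k : ℕ) : 0 ≤ corrBound N j k := by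
  unfold corrBound
  positivity

lemma sum_corrBound_le {N : ℕ} (hN : 0 < N) (K : ℕ) :
    ∑ j ∈ Finset.range K, ∑ k ∈ Finset.range K, corrBound N j k ≤ 9 / (N : ℝ) := by
  have hN' : (0 : ℝ) < N := by exact_mod_cast hN
  simp only [corrBound, Finset.sum_add_distrib, ← Finset.mul_sum, ← Finset.sum_mul]
  have h1 : ∀ j : ℕ, ∑ k ∈ Finset.range K, (if j + 1 ≤ N ∧ N < j + k + 2 ∧ k < j + N then
      4 / (((j : ℝ) + 1) * N ^ 2) else 0) ≤ if j < N then 8 / (N : ℝ) ^ 2 else 0 := by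
    intro j
    rw [← Finset.sum_filter, Finset.sum_const, nsmul_eq_mul]
    split_ifs with hj
    · have hc : ((Finset.range K).filter fun k => j + 1 ≤ N ∧ N < j + k + 2 ∧ k < j + N).card ≤
          2 * (j + 1) := by
        calc _ ≤ (Finset.Ico (N - (j + 1)) (j + N)).card := Finset.card_le_card fun k hk => by
              simp only [Finset.mem_filter, Finset.mem_Ico] at hk ⊢
              omega
          _ ≤ _ := by rw [Nat.card_Ico]; omega
      have hc' : (((Finset.range K).filter fun k => j + 1 ≤ N ∧ N < j + k + 2 ∧ k < j + N).card : ℝ)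
          ≤ 2 * (j + 1) := by exact_mod_cast hc
      calc _ ≤ 2 * ((j : ℝ) + 1) * (4 / (((j : ℝ) + 1) * N ^ 2)) := by gcongr
        _ = _ := by field_simp; ring
    · rw [Finset.filter_false_of_mem fun k _ => by omega]
      simp
  have h2 : ∑ j ∈ Finset.range K, (if j < N then 8 / (N : ℝ) ^ 2 else 0) ≤ 8 / (N : ℝ) := by
    rw [← Finset.sum_filter, Finset.sum_const, nsmul_eq_mul]
    have hc : ((Finset.range K).filter fun j => j < N).card ≤ N := by
      calc _ ≤ (Finset.range N).card := Finset.card_le_card fun k hk => by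
            simp only [Finset.mem_filter, Finset.mem_range] at hk ⊢
            omega
        _ = _ := Finset.card_range N
    calc _ ≤ (N : ℝ) * (8 / (N : ℝ) ^ 2) := by gcongr
      _ = _ := by field_simp
  have h3 := sum_range_ite_inv_sq_le hN K
  have h4 : 0 ≤ ∑ k ∈ Finset.range K, (if N ≤ k then 1 / ((k : ℝ) + 1) ^ 2 else 0) :=
    Finset.sum_nonneg fun k _ => by split_ifs <;> positivity
  calc _ ≤ 8 / (N : ℝ) + 1 / N * (N * (1 / N)) :=
        add_le_add ((Finset.sum_le_sum fun j _ => h1 j).trans h2) (by gcongr)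
    _ = _ := by field_simp; ring

lemma abs_div_le_corrBound_of_le {N j k : ℕ} (hN : 0 < N) (hjk : j ≤ k) {c : ℝ}
    (h1 : |c| ≤ (min (j + 1) N : ℕ)) (h2 : c ≠ 0 → N < j + k + 2 ∧ k < j + N) :
    |c| / (((j : ℝ) + 1) ^ 2 * ((k : ℝ) + 1) ^ 2) ≤ corrBound N j k := by
  have hN' : (0 : ℝ) < N := by exact_mod_cast hN
  rcases eq_or_ne c 0 with rfl | hc
  · simpa using corrBound_nonneg N j k
  obtain ⟨h3, h4⟩ := h2 hc
  unfold corrBound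
  rcases Nat.lt_or_ge j N with hj | hj
  · rw [if_pos ⟨hj, h3, h4⟩, if_neg (by omega), zero_mul, add_zero]
    have h5 : |c| ≤ (j : ℝ) + 1 := h1.trans (by exact_mod_cast min_le_left _ _)
    have h6 : (N : ℝ) ≤ 2 * ((k : ℝ) + 1) := by exact_mod_cast (by omega : N ≤ 2 * (k + 1))
    calc |c| / (((j : ℝ) + 1) ^ 2 * ((k : ℝ) + 1) ^ 2)
        ≤ ((j : ℝ) + 1) / (((j : ℝ) + 1) ^ 2 * (N / 2) ^ 2) := by
          gcongr
          linarith
      _ = _ := by field_simp; ring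
  · rw [if_neg (by omega), if_pos hj, if_pos (by omega), zero_add]
    have h5 : |c| ≤ N := h1.trans (by exact_mod_cast min_le_right _ _)
    calc |c| / (((j : ℝ) + 1) ^ 2 * ((k : ℝ) + 1) ^ 2)
        ≤ (N : ℝ) / (((j : ℝ) + 1) ^ 2 * ((k : ℝ) + 1) ^ 2) := by gcongr
      _ = _ := by field_simp

open Filter Topology

lemma norm_trace_pow_le {N : ℕ} {A : Matrix (Fin N) (Fin N) ℂ}
    (hA : A ∈ Matrix.unitaryGroup (Fin N) ℂ) (k : ℕ) : ‖(A ^ k).trace‖ ≤ N := by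
  have hk : A ^ k ∈ Matrix.unitaryGroup (Fin N) ℂ := pow_mem hA k
  calc ‖(A ^ k).trace‖ ≤ ∑ i : Fin N, ‖(A ^ k) i i‖ := norm_sum_le _ _
    _ ≤ ∑ _i : Fin N, (1 : ℝ) := Finset.sum_le_sum fun i _ => entry_norm_bound_of_unitary hk i i
    _ = N := by simp

/-- The summands of `Q`. -/
def traceTerm {N : ℕ} (k : ℕ) (A : Matrix (Fin N) (Fin N) ℂ) : ℝ :=
  ‖(A ^ (k + 1)).trace‖ ^ 2 / ((k : ℝ) + 1) ^ 2

/-- The partial sums of `Q`. -/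
def partialQ {N : ℕ} (K : ℕ) (A : Matrix (Fin N) (Fin N) ℂ) : ℝ :=
  2 * ∑ k ∈ Finset.range K, traceTerm k A

lemma traceTerm_nonneg {N : ℕ} (k : ℕ) (A : Matrix (Fin N) (Fin N) ℂ) : 0 ≤ traceTerm k A := by
  unfold traceTerm
  positivity

lemma hasSum_inv_succ_sq :
    HasSum (fun k : ℕ => 1 / ((k : ℝ) + 1) ^ 2) (Real.pi ^ 2 / 6) := by
  have h := (hasSum_nat_add_iff' 1).2 hasSum_zeta_two
  simpa using h

lemma traceTerm_le {N : ℕ} {A : Matrix (Fin N) (Fin N) ℂ}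
    (hA : A ∈ Matrix.unitaryGroup (Fin N) ℂ) (k : ℕ) :
    traceTerm k A ≤ (N : ℝ) ^ 2 * (1 / ((k : ℝ) + 1) ^ 2) := by
  rw [mul_one_div, traceTerm]
  have := norm_trace_pow_le hA (k + 1)
  gcongr

lemma summable_traceTerm {N : ℕ} {A : Matrix (Fin N) (Fin N) ℂ}
    (hA : A ∈ Matrix.unitaryGroup (Fin N) ℂ) : Summable fun k => traceTerm k A :=
  Summable.of_nonneg_of_le (fun k => traceTerm_nonneg k A) (traceTerm_le hA)
    (hasSum_inv_succ_sq.summable.mul_left _)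

lemma tendsto_partialQ {N : ℕ} {A : Matrix (Fin N) (Fin N) ℂ}
    (hA : A ∈ Matrix.unitaryGroup (Fin N) ℂ) :
    Tendsto (fun K => partialQ K A) atTop (𝓝 (Q N A)) :=
  (summable_traceTerm hA).hasSum.tendsto_sum_nat.const_mul 2

lemma norm_partialQ_le {N : ℕ} {A : Matrix (Fin N) (Fin N) ℂ}
    (hA : A ∈ Matrix.unitaryGroup (Fin N) ℂ) (K : ℕ) :
    ‖partialQ K A‖ ≤ 2 * ((N : ℝ) ^ 2 * (Real.pi ^ 2 / 6)) := by
  rw [partialQ, Real.norm_of_nonneg (mul_nonneg zero_le_two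
    (Finset.sum_nonneg fun k _ => traceTerm_nonneg k A))]
  refine mul_le_mul_of_nonneg_left ?_ zero_le_two
  exact (Finset.sum_le_sum fun k _ => traceTerm_le hA k).trans
    (sum_le_hasSum _ (fun k _ => by positivity) (hasSum_inv_succ_sq.mul_left _))

namespace IsUnitaryHaar

variable {N : ℕ} {μ : Measure (Matrix (Fin N) (Fin N) ℂ)}

lemma aestronglyMeasurable_traceTerm (h : IsUnitaryHaar μ) (k : ℕ) :
    AEStronglyMeasurable (traceTerm (N := N) k) μ := by
  have h1 := (((measurable_eval_entryVal (traceHom N (MvPolynomial.X ((k + 1 : ℕ) : ℤ)))).norm.pow_const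
    2).div_const (((k : ℝ) + 1) ^ 2)).aestronglyMeasurable (μ := μ)
  exact h1.congr (h.ae_mem.mono fun A hA => by
    change ‖_‖ ^ 2 / _ = _
    rw [eval_traceHom_X hA, traceTerm])

lemma aestronglyMeasurable_partialQ (h : IsUnitaryHaar μ) (K : ℕ) :
    AEStronglyMeasurable (partialQ (N := N) K) μ :=
  (Finset.aestronglyMeasurable_fun_sum _ fun k _ => h.aestronglyMeasurable_traceTerm k).const_mul 2

lemma ae_tendsto_partialQ (h : IsUnitaryHaar μ) :
    ∀ᵐ A ∂μ, Tendsto (fun K => partialQ K A) atTop (𝓝 (Q N A)) :=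
  h.ae_mem.mono fun _ hA => tendsto_partialQ hA

lemma memLp_Q (h : IsUnitaryHaar μ) : MemLp (Q N) 2 μ := by
  have := h.prob
  refine MemLp.of_bound (aestronglyMeasurable_of_tendsto_ae atTop h.aestronglyMeasurable_partialQ
    h.ae_tendsto_partialQ) (2 * ((N : ℝ) ^ 2 * (Real.pi ^ 2 / 6))) ?_
  filter_upwards [h.ae_mem] with A hA
  exact le_of_tendsto (tendsto_partialQ hA).norm (Eventually.of_forall (norm_partialQ_le hA))

lemma tendsto_integral_partialQ_pow (h : IsUnitaryHaar μ) (p : ℕ) :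
    Tendsto (fun K => ∫ A, partialQ K A ^ p ∂μ) atTop (𝓝 (∫ A, Q N A ^ p ∂μ)) := by
  have := h.prob
  refine tendsto_integral_of_dominated_convergence
    (fun _ => (2 * ((N : ℝ) ^ 2 * (Real.pi ^ 2 / 6))) ^ p)
    (fun K => (h.aestronglyMeasurable_partialQ K).pow p) (integrable_const _)
    (fun K => h.ae_mem.mono fun A hA => ?_) (h.ae_tendsto_partialQ.mono fun A hA => hA.pow p)
  rw [norm_pow]
  exact pow_le_pow_left₀ (norm_nonneg _) (norm_partialQ_le hA K) p

lemma integrable_traceTerm (h : IsUnitaryHaar μ) (k : ℕ) : Integrable (traceTerm (N := N) k) μ := by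
  have := h.prob
  refine Integrable.of_bound (h.aestronglyMeasurable_traceTerm k)
    ((N : ℝ) ^ 2 * (1 / ((k : ℝ) + 1) ^ 2)) (h.ae_mem.mono fun A hA => ?_)
  rw [Real.norm_of_nonneg (traceTerm_nonneg k A)]
  exact traceTerm_le hA k

lemma integrable_traceTerm_mul (h : IsUnitaryHaar μ) (j k : ℕ) :
    Integrable (fun A : Matrix (Fin N) (Fin N) ℂ => traceTerm j A * traceTerm k A) μ := by
  have := h.prob
  refine (h.integrable_traceTerm k).bdd_mul (h.aestronglyMeasurable_traceTerm j)
    (c := (N : ℝ) ^ 2 * (1 / ((j : ℝ) + 1) ^ 2)) (h.ae_mem.mono fun A hA => ?_)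
  rw [Real.norm_of_nonneg (traceTerm_nonneg j A)]
  exact traceTerm_le hA j

lemma integral_partialQ (h : IsUnitaryHaar μ) (K : ℕ) : ∫ A, partialQ K A ∂μ =
    2 * ∑ k ∈ Finset.range K, ((min (k + 1) N : ℕ) : ℝ) / ((k : ℝ) + 1) ^ 2 := by
  simp only [partialQ]
  rw [integral_const_mul, integral_finsetSum _ fun k _ => h.integrable_traceTerm k]
  congr 1
  refine Finset.sum_congr rfl fun k _ => ?_
  simp only [traceTerm]
  rw [integral_div, h.integral_norm_trace_sq (by omega)]

lemma exists_integral_traceTerm_mul (h : IsUnitaryHaar μ) (hN : 0 < N) (j k : ℕ) :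
    ∃ c : ℝ, ∫ A, traceTerm (N := N) j A * traceTerm k A ∂μ =
        ((min (j + 1) N : ℕ) / ((j : ℝ) + 1) ^ 2) * ((min (k + 1) N : ℕ) / ((k : ℝ) + 1) ^ 2) +
          (if j = k then ((min (j + 1) N : ℕ) : ℝ) ^ 2 / ((j : ℝ) + 1) ^ 4 else 0) + c ∧
      |c| ≤ corrBound N j k + corrBound N k j := by
  wlog hjk : j ≤ k generalizing j k
  · obtain ⟨c, h1, h2⟩ := this k j (by omega)
    refine ⟨c, ?_, by rwa [add_comm]⟩
    simp only [mul_comm (traceTerm j _)]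
    rw [h1, if_neg (by omega), if_neg (by omega)]
    ring
  · obtain ⟨c, h1, h2, h3⟩ := h.exists_integral_norm_trace_sq_mul_eq_of_le hN
      (Nat.succ_pos j) (Nat.succ_le_succ hjk)
    refine ⟨c / (((j : ℝ) + 1) ^ 2 * ((k : ℝ) + 1) ^ 2), ?_, ?_⟩
    · simp only [traceTerm, div_mul_div_comm]
      rw [integral_div, h1]
      rcases eq_or_ne j k with rfl | hne
      · rw [if_pos rfl, if_pos rfl]
        field_simp
      · rw [if_neg (by omega), if_neg hne]
        ring
    · rw [abs_div, abs_of_pos (a := ((j : ℝ) + 1) ^ 2 * ((k : ℝ) + 1) ^ 2) (by positivity)]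
      exact (abs_div_le_corrBound_of_le hN hjk h2 fun hc => by
        have := h3 hc
        omega).trans (le_add_of_nonneg_right (corrBound_nonneg _ _ _))

lemma abs_integral_partialQ_sq_sub_le (h : IsUnitaryHaar μ) (hN : 0 < N) (K : ℕ) :
    |(∫ A, partialQ K A ^ 2 ∂μ) - (∫ A, partialQ K A ∂μ) ^ 2 -
      4 * ∑ k ∈ Finset.range K, 1 / ((k : ℝ) + 1) ^ 2| ≤ 76 / (N : ℝ) := by
  choose c hc1 hc2 using h.exists_integral_traceTerm_mul hN
  have e1 : ∀ A : Matrix (Fin N) (Fin N) ℂ, partialQ K A ^ 2 =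
      4 * ∑ j ∈ Finset.range K, ∑ k ∈ Finset.range K, traceTerm j A * traceTerm k A := fun A => by
    rw [partialQ, ← Finset.sum_mul_sum]
    ring
  have e2 : ∫ A, partialQ K A ^ 2 ∂μ = 4 * ∑ j ∈ Finset.range K, ∑ k ∈ Finset.range K,
      ∫ A, traceTerm (N := N) j A * traceTerm k A ∂μ := by
    simp only [e1]
    rw [integral_const_mul, integral_finsetSum _ fun j _ =>
      integrable_finsetSum _ fun k _ => h.integrable_traceTerm_mul j k]
    congr 1
    exact Finset.sum_congr rfl fun j _ =>
      integral_finsetSum _ fun k _ => h.integrable_traceTerm_mul j k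
  have e3 : (∫ A, partialQ K A ^ 2 ∂μ) - (∫ A, partialQ K A ∂μ) ^ 2 -
      4 * ∑ k ∈ Finset.range K, 1 / ((k : ℝ) + 1) ^ 2 =
      4 * (∑ k ∈ Finset.range K, ((min (k + 1) N : ℕ) : ℝ) ^ 2 / ((k : ℝ) + 1) ^ 4 -
        ∑ k ∈ Finset.range K, 1 / ((k : ℝ) + 1) ^ 2) +
      4 * ∑ j ∈ Finset.range K, ∑ k ∈ Finset.range K, c j k := by
    have e4 : ∑ j ∈ Finset.range K, ∑ k ∈ Finset.range K,
        (if j = k then ((min (j + 1) N : ℕ) : ℝ) ^ 2 / ((j : ℝ) + 1) ^ 4 else 0) =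
        ∑ k ∈ Finset.range K, ((min (k + 1) N : ℕ) : ℝ) ^ 2 / ((k : ℝ) + 1) ^ 4 :=
      Finset.sum_congr rfl fun j hj => by rw [Finset.sum_ite_eq, if_pos hj]
    rw [e2, h.integral_partialQ]
    simp only [hc1, Finset.sum_add_distrib]
    rw [e4, ← Finset.sum_mul_sum]
    ring
  have h1 := abs_sum_min_sq_div_sub_le hN K
  have h2 : |∑ j ∈ Finset.range K, ∑ k ∈ Finset.range K, c j k| ≤ 9 / N + 9 / N := by
    calc _ ≤ ∑ j ∈ Finset.range K, ∑ k ∈ Finset.range K, |c j k| :=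
          (Finset.abs_sum_le_sum_abs _ _).trans
            (Finset.sum_le_sum fun j _ => Finset.abs_sum_le_sum_abs _ _)
      _ ≤ ∑ j ∈ Finset.range K, ∑ k ∈ Finset.range K, (corrBound N j k + corrBound N k j) :=
          Finset.sum_le_sum fun j _ => Finset.sum_le_sum fun k _ => hc2 j k
      _ ≤ _ := by
          simp only [Finset.sum_add_distrib]
          refine add_le_add (sum_corrBound_le hN K) ?_
          rw [Finset.sum_comm]
          exact sum_corrBound_le hN K
  rw [e3]
  refine (abs_add_le _ _).trans ?_
  rw [abs_mul, abs_mul, abs_of_pos (zero_lt_four' ℝ)]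
  calc _ ≤ 4 * (1 / (N : ℝ)) + 4 * (9 / N + 9 / N) := by gcongr
    _ = _ := by ring

lemma abs_integral_Q_sub_le (h : IsUnitaryHaar μ) (hN : 0 < N) :
    |(∫ A, Q N A ∂μ) - 2 * Real.log N - (2 * Real.eulerMascheroniConstant + 2)| ≤ 76 / (N : ℝ) := by
  have hN' : (0 : ℝ) < N := by exact_mod_cast hN
  have h1 : Tendsto (fun K => ∫ A, partialQ K A ∂μ) atTop (𝓝 (∫ A, Q N A ∂μ)) := by
    simpa using h.tendsto_integral_partialQ_pow 1
  have h2 : |(∫ A, Q N A ∂μ) - 2 * (harmonic N : ℝ) - 2| ≤ 2 * (2 / N) := by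
    refine le_of_tendsto ((h1.sub_const _).sub_const _).abs
      (eventually_atTop.2 ⟨N * N, fun K hK => ?_⟩)
    rw [h.integral_partialQ, ← mul_sub, ← mul_sub_one, abs_mul, abs_of_pos (zero_lt_two' ℝ)]
    exact mul_le_mul_of_nonneg_left (abs_sum_min_div_sq_sub_le hN hK) zero_le_two
  have h3 := abs_harmonic_sub_le hN
  have h4 : 0 < 1 / (N : ℝ) := by positivity
  have h5 : 2 * (2 / (N : ℝ)) = 4 * (1 / N) := by ring
  have h6 : 76 / (N : ℝ) = 76 * (1 / N) := by ring
  rw [abs_le] at h2 h3 ⊢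
  constructor <;> linarith

lemma abs_variance_Q_sub_le (h : IsUnitaryHaar μ) (hN : 0 < N) :
    |variance (Q N) μ - 2 * Real.pi ^ 2 / 3| ≤ 76 / (N : ℝ) := by
  have := h.prob
  have h1 : Tendsto (fun K => ∫ A, partialQ K A ∂μ) atTop (𝓝 (∫ A, Q N A ∂μ)) := by
    simpa using h.tendsto_integral_partialQ_pow 1
  rw [variance_eq_sub h.memLp_Q, show 2 * Real.pi ^ 2 / 3 = 4 * (Real.pi ^ 2 / 6) by ring]
  simp only [Pi.pow_apply]
  exact le_of_tendsto (((h.tendsto_integral_partialQ_pow 2).sub (h1.pow 2)).sub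
    (hasSum_inv_succ_sq.tendsto_sum_nat.const_mul 4)).abs
    (Eventually.of_forall (h.abs_integral_partialQ_sq_sub_le hN))

end IsUnitaryHaar

/-- There is a universal constant `C > 0` such that for all `N ≥ 1` and `A` Haar-distributed
on `U(N)`: `|E[Q_N] − 2 log N − (2γ + 2)| ≤ C/N` and `|Var(Q_N) − 2π²/3| ≤ C/N`. -/
theorem expectation_variance_asymptotics_unitary :
    ∃ C : ℝ, 0 < C ∧ ∀ N : ℕ, 1 ≤ N →
      ∀ μ : Measure (Matrix (Fin N) (Fin N) ℂ), IsProbabilityMeasure μ →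
        μ {A | A ∈ Matrix.unitaryGroup (Fin N) ℂ} = 1 →
        (∀ g ∈ Matrix.unitaryGroup (Fin N) ℂ, μ.map (fun A => g * A) = μ) →
        |(∫ A, Q N A ∂μ) - 2 * Real.log N - (2 * Real.eulerMascheroniConstant + 2)| ≤ C / N ∧
        |variance (Q N) μ - 2 * Real.pi ^ 2 / 3| ≤ C / N := by
  refine ⟨76, by norm_num, fun N hN μ hμ hU hinv => ?_⟩
  have h : IsUnitaryHaar μ :=
    ⟨hμ, (mem_ae_iff_prob_eq_one (measurableSet_unitaryGroup N)).2 hU, hinv⟩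
  exact ⟨h.abs_integral_Q_sub_le hN, h.abs_variance_Q_sub_le hN⟩
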